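/- Suppose 1 < n < m − 1. Then the Vietoris–Rips complex VR(F_n^m, 2) is homotopy equivalent to ( ∨_{(m−1 choose n+1)·(n choose 2)} S² ) ∨ VR(F_{n−1}^{m−1}, 2), i.e., the wedge sum of (m−1 choose n+1)·(n choose 2) copies of the 2-sphere with the Vietoris–Rips complex of F_{n−1}^{m−1} at scale 2. -/

import Mathlib

open Finset

/-- An abstract simplicial complex on a vertex type `V`: a collection of nonempty
finite subsets of `V` (the faces), closed under taking nonempty subsets. -/
structure AbsSC (V : Type) where
  faces : Set (Finset V)
  not_empty_mem : ∅ ∉ faces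
  down_closed : ∀ s ∈ faces, ∀ t : Finset V, t ⊆ s → t ≠ ∅ → t ∈ faces

namespace AbsSC

variable {V W : Type}

/-- The vertex set of a simplicial complex. -/
def vertices (K : AbsSC V) : Set V := {v | ({v} : Finset V) ∈ K.faces}

/-- The geometric realization of a simplicial complex: the space of convex weightings
supported on a face, topologized as a subspace of `V → ℝ`. -/
def space (K : AbsSC V) : Type :=
  {f : V → ℝ // (∀ v, 0 ≤ f v) ∧ ∃ s ∈ K.faces, (∀ v, f v ≠ 0 → v ∈ s) ∧ ∑ v ∈ s, f v = 1}

instance (K : AbsSC V) : TopologicalSpace K.space := by unfold space; infer_instance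

/-- `L` is a subcomplex of `K`. -/
def IsSubcomplex (L K : AbsSC V) : Prop := L.faces ⊆ K.faces

/-- Homotopy equivalence of simplicial complexes (of their geometric realizations). -/
def HEquiv (K : AbsSC V) (L : AbsSC W) : Prop :=
  Nonempty (ContinuousMap.HomotopyEquiv K.space L.space)

/-- The realization of `K` is homotopy equivalent to the topological space `X`. -/
def HEquivTop (K : AbsSC V) (X : Type) [TopologicalSpace X] : Prop :=
  Nonempty (ContinuousMap.HomotopyEquiv K.space X)

/-- The inclusion of realizations induced by a subcomplex inclusion. -/
def incl {L K : AbsSC V} (h : L.faces ⊆ K.faces) : C(L.space, K.space) where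
  toFun f := ⟨f.1, f.2.1, by obtain ⟨s, hs, h1, h2⟩ := f.2.2; exact ⟨s, h hs, h1, h2⟩⟩
  continuous_toFun := Continuous.subtype_mk continuous_subtype_val _

variable [DecidableEq V]

/-- The link of a vertex. -/
def link (K : AbsSC V) (v : V) : AbsSC V where
  faces := {σ | σ ≠ ∅ ∧ v ∉ σ ∧ σ ∪ {v} ∈ K.faces}
  not_empty_mem h := h.1 rfl
  down_closed := by
    rintro s ⟨hne, hv, hs⟩ t hts htne
    exact ⟨htne, fun hvt => hv (hts hvt),
      K.down_closed _ hs _ (Finset.union_subset_union hts (Finset.Subset.refl _)) (by simp [Finset.union_eq_empty])⟩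

lemma link_subset (K : AbsSC V) (v : V) : (K.link v).faces ⊆ K.faces := by
  rintro σ ⟨hne, hv, hσ⟩
  exact K.down_closed _ hσ _ Finset.subset_union_left hne

/-- The complex induced on the vertices other than `v`. -/
def delete (K : AbsSC V) (v : V) : AbsSC V where
  faces := {σ | σ ∈ K.faces ∧ v ∉ σ}
  not_empty_mem h := K.not_empty_mem h.1
  down_closed := by
    rintro s ⟨hs, hv⟩ t hts htne
    exact ⟨K.down_closed _ hs _ hts htne, fun h => hv (hts h)⟩

/-- The star of a vertex: `st_K(v) = {σ : σ ∪ {v} ∈ K}`. -/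
def star (K : AbsSC V) (v : V) : AbsSC V where
  faces := {σ | σ ≠ ∅ ∧ σ ∪ {v} ∈ K.faces}
  not_empty_mem h := h.1 rfl
  down_closed := by
    rintro s ⟨hne, hs⟩ t hts htne
    exact ⟨htne,
      K.down_closed _ hs _ (Finset.union_subset_union hts (Finset.Subset.refl _)) (by simp [Finset.union_eq_empty])⟩

/-- The star cluster of a subcomplex `L` in `K`: the union of stars of vertices of `L`. -/
def starCluster (K L : AbsSC V) : AbsSC V where
  faces := {σ | σ ≠ ∅ ∧ ∃ v, ({v} : Finset V) ∈ L.faces ∧ σ ∪ {v} ∈ K.faces}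
  not_empty_mem h := h.1 rfl
  down_closed := by
    rintro s ⟨hne, v, hvL, hs⟩ t hts htne
    exact ⟨htne, v, hvL,
      K.down_closed _ hs _ (Finset.union_subset_union hts (Finset.Subset.refl _)) (by simp [Finset.union_eq_empty])⟩

/-- The union of two simplicial complexes. -/
def union (K₁ K₂ : AbsSC V) : AbsSC V where
  faces := K₁.faces ∪ K₂.faces
  not_empty_mem h := by
    rcases h with h | h
    exacts [K₁.not_empty_mem h, K₂.not_empty_mem h]
  down_closed := by
    rintro s (hs | hs) t hts htne
    exacts [Or.inl (K₁.down_closed _ hs _ hts htne), Or.inr (K₂.down_closed _ hs _ hts htne)]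

/-- The union of a family of simplicial complexes. -/
def iUnionC {ι : Type} (F : ι → AbsSC V) : AbsSC V where
  faces := ⋃ i, (F i).faces
  not_empty_mem h := by
    obtain ⟨i, hi⟩ := Set.mem_iUnion.mp h
    exact (F i).not_empty_mem hi
  down_closed := by
    intro s hs t hts htne
    obtain ⟨i, hi⟩ := Set.mem_iUnion.mp hs
    exact Set.mem_iUnion.mpr ⟨i, (F i).down_closed _ hi _ hts htne⟩

/-- The `n`-skeleton of a complex: all faces with at most `n+1` vertices. -/
def skeleton (K : AbsSC V) (n : ℕ) : AbsSC V where
  faces := {σ | σ ∈ K.faces ∧ σ.card ≤ n + 1}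
  not_empty_mem h := K.not_empty_mem h.1
  down_closed := by
    rintro s ⟨hs, hcard⟩ t hts htne
    exact ⟨K.down_closed _ hs _ hts htne, le_trans (Finset.card_le_card hts) hcard⟩

/-- The simplicial complex generated by a single simplex `s` (all its nonempty subsets). -/
def simplexCx (s : Finset V) : AbsSC V where
  faces := {t | t ≠ ∅ ∧ t ⊆ s}
  not_empty_mem h := h.1 rfl
  down_closed := by
    rintro a ⟨hne, has⟩ t hta htne
    exact ⟨htne, hta.trans has⟩

/-- A maximal simplex (facet) of `K`. -/
def IsFacet (K : AbsSC V) (σ : Finset V) : Prop :=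
  σ ∈ K.faces ∧ ∀ τ ∈ K.faces, σ ⊆ τ → τ = σ

/-- `K` is a clique complex: any nonempty set of vertices which pairwise span edges is a face. -/
def IsCliqueCx (K : AbsSC V) : Prop :=
  ∀ σ : Finset V, σ ≠ ∅ → (∀ v ∈ σ, ({v} : Finset V) ∈ K.faces) →
    (∀ v ∈ σ, ∀ w ∈ σ, v ≠ w → ({v, w} : Finset V) ∈ K.faces) → σ ∈ K.faces

/-- `L` is a full subcomplex of `K`. -/
def IsFull (L K : AbsSC V) : Prop :=
  ∀ σ ∈ K.faces, (∀ v ∈ σ, ({v} : Finset V) ∈ L.faces) → σ ∈ L.faces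

end AbsSC

noncomputable section

/-- The `n`-dimensional sphere. -/
abbrev Sph (n : ℕ) : Type := Metric.sphere (0 : EuclideanSpace ℝ (Fin (n + 1))) 1

/-- A base point on the sphere. -/
def sphBase (n : ℕ) : Sph n :=
  ⟨EuclideanSpace.single 0 1, by simp⟩

/-- Relation gluing the base points of `c` copies of a pointed space to an auxiliary point. -/
inductive wedgeRel (c : ℕ) (X : Type) (x₀ : X) : Unit ⊕ Fin c × X → Unit ⊕ Fin c × X → Prop
  | glue (i : Fin c) : wedgeRel c X x₀ (Sum.inl ()) (Sum.inr (i, x₀))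

/-- The wedge sum of `c` copies of the pointed space `(X, x₀)`. -/
def Wedge (c : ℕ) (X : Type) [TopologicalSpace X] (x₀ : X) : Type := Quot (wedgeRel c X x₀)

instance (c : ℕ) (X : Type) [TopologicalSpace X] (x₀ : X) : TopologicalSpace (Wedge c X x₀) := by
  unfold Wedge; infer_instance

/-- The base point of the wedge. -/
def wedgePt (c : ℕ) (X : Type) [TopologicalSpace X] (x₀ : X) : Wedge c X x₀ :=
  Quot.mk _ (Sum.inl ())

/-- The wedge sum of `c` copies of the `n`-sphere. -/
abbrev WedgeSph (n c : ℕ) : Type := Wedge c (Sph n) (sphBase n)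

/-- The base point of a wedge of spheres. -/
def wedgeSphPt (n c : ℕ) : WedgeSph n c := wedgePt c _ _

/-- Relation gluing the two base points in a binary wedge. -/
inductive wedge2Rel (X Y : Type) (x₀ : X) (y₀ : Y) : X ⊕ Y → X ⊕ Y → Prop
  | glue : wedge2Rel X Y x₀ y₀ (Sum.inl x₀) (Sum.inr y₀)

/-- The wedge sum `X ∨ Y` of two pointed spaces. -/
def Wedge2 (X Y : Type) [TopologicalSpace X] [TopologicalSpace Y] (x₀ : X) (y₀ : Y) : Type :=
  Quot (wedge2Rel X Y x₀ y₀)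

instance (X Y : Type) [TopologicalSpace X] [TopologicalSpace Y] (x₀ : X) (y₀ : Y) :
    TopologicalSpace (Wedge2 X Y x₀ y₀) := by unfold Wedge2; infer_instance

/-- Relation collapsing the top and bottom of the cylinder `X × [0,1]` to two cone points. -/
inductive suspRel (X : Type) : X × unitInterval ⊕ Bool → X × unitInterval ⊕ Bool → Prop
  | zero (x : X) : suspRel X (Sum.inl (x, 0)) (Sum.inr false)
  | one (x : X) : suspRel X (Sum.inl (x, 1)) (Sum.inr true)

/-- The (unreduced) suspension `Σ X`. -/
def Susp (X : Type) [TopologicalSpace X] : Type := Quot (suspRel X)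

instance (X : Type) [TopologicalSpace X] : TopologicalSpace (Susp X) := by
  unfold Susp; infer_instance

/-- The north cone point of the suspension. -/
def suspNorth (X : Type) [TopologicalSpace X] : Susp X := Quot.mk _ (Sum.inr true)

end

/-- The Vietoris–Rips complex at scale `r` of a collection `F` of finite subsets of `ℕ`,
with respect to the symmetric difference metric `d(A,B) = |A Δ B|`. -/
def VRc (F : Set (Finset ℕ)) (r : ℕ) : AbsSC (Finset ℕ) where
  faces := {σ | σ.Nonempty ∧ (∀ A ∈ σ, A ∈ F) ∧
    ∀ A ∈ σ, ∀ B ∈ σ, (symmDiff A B).card ≤ r}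
  not_empty_mem h := by simpa using h.1
  down_closed := by
    rintro s ⟨hne, hF, hd⟩ t hts htne
    exact ⟨Finset.nonempty_iff_ne_empty.mpr htne, fun A hA => hF A (hts hA),
      fun A hA B hB => hd A (hts hA) B (hts hB)⟩

/-- `F_n^m`: all `n`-element subsets of `[m] = {1, …, m}`. -/
def Fnm (m n : ℕ) : Set (Finset ℕ) := {A | A ⊆ Finset.Icc 1 m ∧ A.card = n}

/-- `F_{≤ n}^m`: all subsets of `[m]` of cardinality at most `n`. -/
def Fle (m n : ℕ) : Set (Finset ℕ) := {A | A ⊆ Finset.Icc 1 m ∧ A.card ≤ n}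

/-- The simplex `N[C] = {A : C ⊆ A, |A \ C| = 1}` inside `[m]`. -/
def NSimp (m : ℕ) (C : Finset ℕ) : Finset (Finset ℕ) :=
  (Finset.Icc 1 m \ C).image (fun x => insert x C)

/-- The simplex `L[S]`: all subsets of `S` obtained by removing one element. -/
def LSimp (S : Finset ℕ) : Finset (Finset ℕ) := S.image (fun x => S.erase x)

/-- The total order `≺`: first compare cardinalities, then compare the increasing
enumerations lexicographically. -/
def precLT (A B : Finset ℕ) : Prop :=
  A.card < B.card ∨
    (A.card = B.card ∧ List.Lex (· < ·) (A.sort (· ≤ ·)) (B.sort (· ≤ ·)))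

/-- `A ⪯ B`. -/
def precLE (A B : Finset ℕ) : Prop := precLT A B ∨ A = B

/-- `F^m_{≺ A}`: all subsets of `[m]` strictly preceding `A`. -/
def FprecLT (m : ℕ) (A : Finset ℕ) : Set (Finset ℕ) :=
  {B | B ⊆ Finset.Icc 1 m ∧ precLT B A}

/-- `F^m_{⪯ A}`: all subsets of `[m]` preceding (or equal to) `A`. -/
def FprecLE (m : ℕ) (A : Finset ℕ) : Set (Finset ℕ) :=
  {B | B ⊆ Finset.Icc 1 m ∧ precLE B A}

/-- The `j`-th value (0-indexed) of an enumeration `i : Fin n → ℕ`. -/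
def ith {n : ℕ} (i : Fin n → ℕ) (j : ℕ) : ℕ := if h : j < n then i ⟨j, h⟩ else 0

/-- The `ℓ`-th entry (1-indexed) of the enumeration, as an integer, with `i_0 = -1`. -/
def ivZ {n : ℕ} (i : Fin n → ℕ) (ℓ : ℕ) : ℤ := if ℓ = 0 then -1 else (ith i (ℓ - 1) : ℤ)

/-- For `B = i_1 i_2 ⋯ i_n` (increasing), with `d_1 = i_1` and
`d_ℓ = i_ℓ - (i_{ℓ-1} + 1)`, `r_B = Σ_{k=2}^{n-2} C(k,2) + Σ_{ℓ=1}^{n-2} d_ℓ·C(n-ℓ,2)`. -/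
def rA (B : Finset ℕ) : ℕ :=
  (∑ k ∈ Finset.Icc 2 (B.card - 2), Nat.choose k 2) +
    ∑ ℓ ∈ Finset.Icc 1 (B.card - 2),
      ((B.sort (· ≤ ·)).getD (ℓ - 1) 0 -
        (if ℓ = 1 then 0 else (B.sort (· ≤ ·)).getD (ℓ - 2) 0 + 1)) * Nat.choose (B.card - ℓ) 2

/-- For `B = i_1 i_2 ⋯ i_n` (increasing), with `c_1 = i_1 - 1` and
`c_ℓ = i_ℓ - (i_{ℓ-1} + 1)`, `s_B = Σ_{k=2}^{n-2} C(k,2) + Σ_{ℓ=1}^{n-2} c_ℓ·C(n-ℓ,2)`. -/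
def sA (B : Finset ℕ) : ℕ :=
  (∑ k ∈ Finset.Icc 2 (B.card - 2), Nat.choose k 2) +
    ∑ ℓ ∈ Finset.Icc 1 (B.card - 2),
      ((B.sort (· ≤ ·)).getD (ℓ - 1) 0 -
        (if ℓ = 1 then 1 else (B.sort (· ≤ ·)).getD (ℓ - 2) 0 + 1)) * Nat.choose (B.card - ℓ) 2

/-- `t_n = Σ_{A ⊆ [m], |A| = n} r_A`. -/
def tN (m n : ℕ) : ℕ :=
  ∑ A ∈ (Finset.Icc 1 m).powerset.filter (fun A => A.card = n), rA A

/-- `o_{m,n} = Σ { s_A : A ∈ F^m_{n+2}, min A ≥ 2 }`. -/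
def omn (m n : ℕ) : ℕ :=
  ∑ A ∈ (Finset.Icc 1 m).powerset.filter (fun A => A.card = n + 2 ∧ ∀ x ∈ A, 2 ≤ x), sA A

namespace AbsSC

section Realization

variable {V : Type} {K : AbsSC V}

/-- The barycentric coordinates of a point of the realization. -/
def space.wt (x : K.space) : V → ℝ := Subtype.val x

/-- The point of the realization with given barycentric coordinates. -/
def space.ofWt (f : V → ℝ) (h0 : ∀ v, 0 ≤ f v)
    (h : ∃ s ∈ K.faces, (∀ v, f v ≠ 0 → v ∈ s) ∧ ∑ v ∈ s, f v = 1) : K.space :=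
  Subtype.mk f ⟨h0, h⟩

@[simp]
theorem space.wt_ofWt (f : V → ℝ) (h0 : ∀ v, 0 ≤ f v)
    (h : ∃ s ∈ K.faces, (∀ v, f v ≠ 0 → v ∈ s) ∧ ∑ v ∈ s, f v = 1) :
    (space.ofWt f h0 h : K.space).wt = f := rfl

theorem space.wt_nonneg (x : K.space) (v : V) : 0 ≤ x.wt v := x.property.1 v

theorem space.exists_face (x : K.space) :
    ∃ s ∈ K.faces, (∀ v, x.wt v ≠ 0 → v ∈ s) ∧ ∑ v ∈ s, x.wt v = 1 := x.property.2

theorem space.continuous_wt : Continuous (fun x : K.space => x.wt) := continuous_subtype_val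

@[fun_prop]
theorem space.continuous_wt_apply (v : V) : Continuous (fun x : K.space => x.wt v) :=
  (continuous_apply v).comp space.continuous_wt

theorem space.continuous_mk {P : Type*} [TopologicalSpace P] {f : P → K.space}
    (h : ∀ v, Continuous fun p => (f p).wt v) : Continuous f :=
  continuous_induced_rng.2 (continuous_pi h)

theorem space.ext_wt {x y : K.space} (h : ∀ v, x.wt v = y.wt v) : x = y := Subtype.ext (funext h)

instance : T2Space K.space := by unfold space; infer_instance

theorem sum_eq_sum_of_support {M : Type} [AddCommMonoid M] {f : V → M} {s u : Finset V}
    (hs : ∀ v, f v ≠ 0 → v ∈ s) (hu : ∀ v, f v ≠ 0 → v ∈ u) : ∑ v ∈ u, f v = ∑ v ∈ s, f v := by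
  classical
  rw [← Finset.sum_filter_ne_zero (s := u), ← Finset.sum_filter_ne_zero (s := s)]
  refine Finset.sum_congr ?_ fun _ _ => rfl
  ext v
  simp only [mem_filter]
  exact ⟨fun h => ⟨hs v h.2, h.2⟩, fun h => ⟨hu v h.2, h.2⟩⟩

theorem space.sum_eq_one (x : K.space) {u : Finset V} (hu : ∀ v, x.wt v ≠ 0 → v ∈ u) :
    ∑ v ∈ u, x.wt v = 1 := by
  obtain ⟨s, -, hsupp, hsum⟩ := x.exists_face
  rw [← hsum, sum_eq_sum_of_support hsupp hu]

theorem space.exists_supp_eq (x : K.space) : ∃ s ∈ K.faces, ∀ v, x.wt v ≠ 0 ↔ v ∈ s := by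
  classical
  obtain ⟨s, hs, hsupp, hsum⟩ := x.exists_face
  refine ⟨s.filter fun v => x.wt v ≠ 0, K.down_closed s hs _ (filter_subset _ _) ?_, fun v => ?_⟩
  · intro h
    rw [← Finset.sum_filter_ne_zero, h] at hsum
    simp at hsum
  · simp only [mem_filter]
    exact ⟨fun h => ⟨hsupp v h, h⟩, fun h => h.2⟩

/-- The points supported on a given simplex. -/
def closedSimplex (s : Finset V) : Set (V → ℝ) :=
  {f | (∀ v, 0 ≤ f v) ∧ (∀ v, f v ≠ 0 → v ∈ s) ∧ ∑ v ∈ s, f v = 1}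

theorem isCompact_closedSimplex (s : Finset V) : IsCompact (closedSimplex s) := by
  have hc : IsCompact (Set.pi Set.univ fun _ : V => Set.Icc (0 : ℝ) 1) :=
    isCompact_univ_pi fun _ => isCompact_Icc
  refine hc.of_isClosed_subset ?_ ?_
  · have : closedSimplex s =
        (⋂ v, {f : V → ℝ | 0 ≤ f v}) ∩ ((⋂ v, ⋂ (_ : v ∉ s), {f : V → ℝ | f v = 0}) ∩
          {f : V → ℝ | ∑ v ∈ s, f v = 1}) := by
      ext f
      simp only [closedSimplex, Set.mem_ofPred_eq, Set.mem_inter_iff, Set.mem_iInter]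
      refine and_congr_right fun _ => and_congr_left fun _ => forall_congr' fun v => ?_
      tauto
    rw [this]
    refine (isClosed_iInter fun v => isClosed_le continuous_const (continuous_apply v)).inter
      ((isClosed_iInter fun v => isClosed_iInter fun _ =>
        isClosed_eq (continuous_apply v) continuous_const).inter
        (isClosed_eq (by fun_prop) continuous_const))
  · rintro f ⟨h0, h1, h2⟩ v -
    refine ⟨h0 v, ?_⟩
    by_cases hv : v ∈ s
    · rw [← h2]
      exact Finset.single_le_sum (fun w _ => h0 w) hv
    · rw [not_imp_comm.1 (h1 v) hv]
      exact zero_le_one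

theorem compactSpace_space (hK : K.faces.Finite) : CompactSpace K.space := by
  have : IsCompact (⋃ s ∈ K.faces, closedSimplex s) :=
    hK.isCompact_biUnion fun s _ => isCompact_closedSimplex s
  have h2 : (⋃ s ∈ K.faces, closedSimplex s) = {f : V → ℝ | (∀ v, 0 ≤ f v) ∧
      ∃ s ∈ K.faces, (∀ v, f v ≠ 0 → v ∈ s) ∧ ∑ v ∈ s, f v = 1} := by
    ext f
    simp only [Set.mem_iUnion, closedSimplex, Set.mem_ofPred_eq, exists_prop]
    constructor
    · rintro ⟨s, hs, h0, h1⟩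
      exact ⟨h0, s, hs, h1⟩
    · rintro ⟨h0, s, hs, h1⟩
      exact ⟨s, hs, h0, h1⟩
  rw [h2] at this
  exact isCompact_iff_compactSpace.1 this

/-- The straight-line homotopy between two maps that lie in a common face at every point. -/
theorem exists_straightLine {P : Type} [TopologicalSpace P] (f g : C(P, K.space))
    (h : ∀ p, ∃ s ∈ K.faces, ∀ v, (f p).wt v ≠ 0 ∨ (g p).wt v ≠ 0 → v ∈ s) :
    ∃ H : f.Homotopy g, ∀ t p, f p = g p → H (t, p) = f p := by
  let F : unitInterval × P → K.space := fun q =>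
    space.ofWt (fun v => (1 - (q.1 : ℝ)) * (f q.2).wt v + q.1 * (g q.2).wt v) (fun v =>
      add_nonneg (mul_nonneg (sub_nonneg.2 q.1.2.2) (space.wt_nonneg _ v))
        (mul_nonneg q.1.2.1 (space.wt_nonneg _ v))) (by
      obtain ⟨s, hs, hv⟩ := h q.2
      refine ⟨s, hs, fun v hne => hv v ?_, ?_⟩
      · by_contra! hcon
        exact hne (by simp [hcon.1, hcon.2])
      · rw [Finset.sum_add_distrib, ← Finset.mul_sum, ← Finset.mul_sum,
          space.sum_eq_one (f q.2) fun v hv' => hv v (Or.inl hv'),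
          space.sum_eq_one (g q.2) fun v hv' => hv v (Or.inr hv')]
        ring)
  have hF : Continuous F := space.continuous_mk fun v => by
    simp only [F, space.wt_ofWt]
    fun_prop
  refine ⟨⟨⟨F, hF⟩, fun p => space.ext_wt fun v => ?_, fun p => space.ext_wt fun v => ?_⟩,
    fun t p hp => space.ext_wt fun v => ?_⟩
  · simp [F]
  · simp [F]
  · change (1 - (t : ℝ)) * (f p).wt v + t * (g p).wt v = _
    rw [← hp]
    ring

end Realization

end AbsSC

/-- The map `i` is the inclusion of a strong deformation retract. -/
def IsStrongDeformationRetract {X' X : Type} [TopologicalSpace X'] [TopologicalSpace X]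
    (i : C(X', X)) : Prop :=
  ∃ r : C(X, X'), r.comp i = ContinuousMap.id X' ∧
    ∃ H : (ContinuousMap.id X).Homotopy (i.comp r), ∀ t x', H (t, i x') = i x'

namespace AbsSC

section Collapse

variable {V : Type}

/-- The least weight on a set of vertices. -/
noncomputable def minWt (f : V → ℝ) (τ : Finset V) : ℝ :=
  if h : τ.Nonempty then τ.inf' h f else 0

theorem continuous_minWt (τ : Finset V) : Continuous fun f : V → ℝ => minWt f τ := by
  unfold minWt
  split_ifs with h
  · exact Continuous.finset_inf'_apply h fun v _ => continuous_apply v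
  · exact continuous_const

theorem minWt_nonneg {f : V → ℝ} (hf : ∀ v, 0 ≤ f v) (τ : Finset V) : 0 ≤ minWt f τ := by
  unfold minWt
  split_ifs with h
  · exact Finset.le_inf' h _ fun v _ => hf v
  · exact le_rfl

theorem minWt_eq_zero {f : V → ℝ} (hf : ∀ v, 0 ≤ f v) {τ : Finset V} {v : V} (hv : v ∈ τ)
    (h0 : f v = 0) : minWt f τ = 0 := by
  refine le_antisymm ?_ (minWt_nonneg hf τ)
  rw [minWt, dif_pos ⟨v, hv⟩, ← h0]
  exact Finset.inf'_le _ hv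

variable [DecidableEq V]

/-- The amount of weight which a vertex sends to the apices of the bad sets containing it. -/
noncomputable def loss (B : Finset (Finset V)) (f : V → ℝ) (v : V) : ℝ :=
  min (f v) (∑ τ ∈ B.filter (v ∈ ·), minWt f τ)

theorem continuous_loss (B : Finset (Finset V)) (v : V) :
    Continuous fun f : V → ℝ => loss B f v := by
  unfold loss
  exact (continuous_apply v).min (continuous_finsetSum _ fun τ _ => continuous_minWt τ)

theorem loss_nonneg (B : Finset (Finset V)) {f : V → ℝ} (hf : ∀ v, 0 ≤ f v) (v : V) :
    0 ≤ loss B f v :=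
  le_min (hf v) (Finset.sum_nonneg fun τ _ => minWt_nonneg hf τ)

theorem loss_eq_zero {B : Finset (Finset V)} {f : V → ℝ} (hf : ∀ v, 0 ≤ f v) {v : V}
    (h : ∀ τ ∈ B, v ∈ τ → ∃ u ∈ τ, f u = 0) : loss B f v = 0 := by
  have : ∑ τ ∈ B.filter (v ∈ ·), minWt f τ = 0 := by
    refine Finset.sum_eq_zero fun τ hτ => ?_
    rw [mem_filter] at hτ
    obtain ⟨u, hu, h0⟩ := h τ hτ.1 hτ.2
    exact minWt_eq_zero hf hu h0
  rw [loss, this, min_eq_right (hf v)]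

/-- The weights obtained by moving the losses to the apices of the bad sets. -/
noncomputable def push (U : Finset V) (B : Finset (Finset V)) (w : Finset V → V) (f : V → ℝ)
    (v : V) : ℝ :=
  f v - loss B f v + ∑ u ∈ U, loss (B.filter fun τ => w τ = v) f u

theorem continuous_push (U : Finset V) (B : Finset (Finset V)) (w : Finset V → V) (v : V) :
    Continuous fun f : V → ℝ => push U B w f v := by
  unfold push
  exact ((continuous_apply v).sub (continuous_loss B v)).add
    (continuous_finsetSum _ fun u _ => continuous_loss _ u)

theorem push_eq_self (U : Finset V) {B : Finset (Finset V)} (w : Finset V → V) {f : V → ℝ}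
    (hf : ∀ v, 0 ≤ f v) (h : ∀ τ ∈ B, ∃ u ∈ τ, f u = 0) : push U B w f = f := by
  funext v
  rw [push, loss_eq_zero hf fun τ hτ _ => h τ hτ, Finset.sum_eq_zero, sub_zero, add_zero]
  exact fun u _ => loss_eq_zero hf fun τ hτ _ => h τ (mem_of_mem_filter τ hτ)

theorem push_eq {U : Finset V} {B : Finset (Finset V)} {w : Finset V → V} {f : V → ℝ}
    (hf : ∀ v, 0 ≤ f v) {σ : Finset V} (hσ : ∀ v, f v ≠ 0 ↔ v ∈ σ) (hU : σ ⊆ U) {a : V}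
    (ha : ∀ τ ∈ B, τ ⊆ σ → w τ = a) (v : V) :
    push U B w f v = f v - loss B f v + if v = a then ∑ u ∈ σ, loss B f u else 0 := by
  have hout : ∀ τ : Finset V, ¬ τ ⊆ σ → ∃ u ∈ τ, f u = 0 := fun τ h => by
    obtain ⟨u, hu, hus⟩ := Finset.not_subset.1 h
    exact ⟨u, hu, by_contra fun h0 => hus ((hσ u).1 h0)⟩
  rw [push]
  congr 1
  split_ifs with hva
  · subst hva
    have hl : ∀ u, loss (B.filter fun τ => w τ = v) f u = loss B f u := fun u => by
      unfold loss
      congr 1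
      refine Finset.sum_subset ?_ fun τ hτ hτ' => ?_
      · exact Finset.filter_subset_filter _ (filter_subset _ _)
      · simp only [mem_filter, not_and] at hτ hτ'
        obtain ⟨z, hz, h0⟩ := hout τ fun hsub => hτ' ⟨hτ.1, ha τ hτ.1 hsub⟩ hτ.2
        exact minWt_eq_zero hf hz h0
    rw [Finset.sum_congr rfl fun u _ => hl u]
    refine (Finset.sum_subset hU fun u _ hu => ?_).symm
    rw [loss, not_imp_comm.1 (hσ u).1 hu]
    exact min_eq_left (Finset.sum_nonneg fun τ _ => minWt_nonneg hf τ)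
  · refine Finset.sum_eq_zero fun u _ => loss_eq_zero hf fun τ hτ _ => ?_
    rw [mem_filter] at hτ
    exact hout τ fun hsub => hva (hτ.2.symm.trans (ha τ hτ.1 hsub))

variable {K : AbsSC V} {bad : Set (Finset V)} {w : Finset V → V}

theorem push_spec
    (h : ∀ σ ∈ K.faces, ∀ τ ∈ bad, τ ⊆ σ → insert (w τ) σ ∈ K.faces ∧
      ∀ τ' ∈ bad, τ' ⊆ insert (w τ) σ → w τ' = w τ ∧ w τ ∉ τ')
    {U : Finset V} (hU : ∀ σ ∈ K.faces, σ ⊆ U) {B : Finset (Finset V)}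
    (hB : ∀ τ, τ ∈ B ↔ τ ∈ K.faces ∧ τ ∈ bad) (x : K.space) :
    (∀ v, 0 ≤ push U B w x.wt v) ∧
    ∃ s ∈ K.faces, (∀ v, x.wt v ≠ 0 ∨ push U B w x.wt v ≠ 0 → v ∈ s) ∧
      ∑ v ∈ s, push U B w x.wt v = 1 ∧
      ∀ τ ∈ bad, τ ≠ ∅ → ∃ v ∈ τ, push U B w x.wt v = 0 := by
  obtain ⟨σ, hσ, hsupp⟩ := x.exists_supp_eq
  by_cases hex : ∃ τ ∈ bad, τ ≠ ∅ ∧ τ ⊆ σ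
  · obtain ⟨τ₀, hτ₀, hne₀, hsub₀⟩ := hex
    obtain ⟨hins, hall⟩ := h σ hσ τ₀ hτ₀ hsub₀
    set a := w τ₀ with ha
    have hpush := push_eq (U := U) (B := B) (w := w) x.wt_nonneg hsupp (hU σ hσ) (a := a)
      fun τ hτ hτσ => (hall τ ((hB τ).1 hτ).2 (hτσ.trans (subset_insert _ _))).1
    have hle : ∀ v, loss B x.wt v ≤ x.wt v := fun v => min_le_left _ _
    have hnn : ∀ v, 0 ≤ push U B w x.wt v := fun v => by
      rw [hpush]
      refine add_nonneg (sub_nonneg.2 (hle v)) ?_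
      split_ifs
      · exact Finset.sum_nonneg fun u _ => loss_nonneg B x.wt_nonneg u
      · exact le_rfl
    have hs : ∀ v, push U B w x.wt v ≠ 0 → v ∈ insert a σ := fun v hv => by
      by_contra hcon
      rw [mem_insert, not_or] at hcon
      apply hv
      have h0 := not_imp_comm.1 (hsupp v).1 hcon.2
      have h1 := hle v
      rw [hpush, if_neg hcon.1, h0]
      have h2 := loss_nonneg B x.wt_nonneg v
      linarith
    refine ⟨hnn, insert a σ, hins, fun v hv => ?_, ?_, fun τ hτ hne => ?_⟩
    · rcases hv with hv | hv
      · exact mem_insert_of_mem ((hsupp v).1 hv)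
      · exact hs v hv
    · simp_rw [hpush]
      rw [Finset.sum_add_distrib, Finset.sum_sub_distrib, Finset.sum_ite_eq' (insert a σ) a,
        if_pos (mem_insert_self _ _),
        x.sum_eq_one fun v hv => mem_insert_of_mem ((hsupp v).1 hv)]
      have : ∑ v ∈ insert a σ, loss B x.wt v = ∑ v ∈ σ, loss B x.wt v := by
        refine (Finset.sum_subset (subset_insert _ _) fun v _ hv => ?_).symm
        have h0 := not_imp_comm.1 (hsupp v).1 hv
        have h1 := hle v
        have h2 := loss_nonneg B x.wt_nonneg v
        linarith
      rw [this]
      ring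
    · by_contra! hcon
      have hsub : τ ⊆ insert a σ := fun v hv => hs v (hcon v hv)
      obtain ⟨-, haτ⟩ := hall τ hτ hsub
      have hne' := nonempty_iff_ne_empty.2 hne
      obtain ⟨v, hv, hmin⟩ := Finset.exists_mem_eq_inf' hne' x.wt
      apply hcon v hv
      rw [hpush, if_neg fun hva : v = a => haτ (hva ▸ hv), add_zero, sub_eq_zero]
      refine (min_eq_left ?_).symm
      have hmem : τ ∈ B.filter (v ∈ ·) := by
        rw [mem_filter, hB]
        exact ⟨⟨K.down_closed _ hins _ hsub hne, hτ⟩, hv⟩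
      refine le_trans ?_ (Finset.single_le_sum (fun τ _ => minWt_nonneg x.wt_nonneg τ) hmem)
      rw [minWt, dif_pos hne', hmin]
  · push Not at hex
    have hself : push U B w x.wt = x.wt := push_eq_self U w x.wt_nonneg fun τ hτ => by
      have hτ' := (hB τ).1 hτ
      have hne : τ ≠ ∅ := fun h0 => K.not_empty_mem (h0 ▸ hτ'.1)
      obtain ⟨u, hu, hus⟩ := Finset.not_subset.1 (hex τ hτ'.2 (nonempty_iff_ne_empty.2 hne))
      exact ⟨u, hu, not_imp_comm.1 (hsupp u).1 hus⟩
    rw [hself]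
    refine ⟨x.wt_nonneg, σ, hσ, fun v hv => (hsupp v).1 (or_self_iff.1 hv),
      x.sum_eq_one fun v hv => (hsupp v).1 hv, fun τ hτ hne => ?_⟩
    obtain ⟨u, hu, hus⟩ := Finset.not_subset.1 (hex τ hτ (nonempty_iff_ne_empty.2 hne))
    exact ⟨u, hu, not_imp_comm.1 (hsupp u).1 hus⟩

/-- If the minimal nonfaces of `L` in `K` are bad sets, each of which has an apex that can be
added to every face containing it and that is shared by all bad sets near that face, then the
realization of `K` deforms onto that of `L`. -/
theorem isStrongDeformationRetract_incl {L : AbsSC V} (hfin : K.faces.Finite)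
    (hne : ∀ τ ∈ bad, τ ≠ ∅)
    (h : ∀ σ ∈ K.faces, ∀ τ ∈ bad, τ ⊆ σ → insert (w τ) σ ∈ K.faces ∧
      ∀ τ' ∈ bad, τ' ⊆ insert (w τ) σ → w τ' = w τ ∧ w τ ∉ τ')
    (hLK : L.faces ⊆ K.faces)
    (hL : ∀ σ, σ ∈ L.faces ↔ σ ∈ K.faces ∧ ∀ τ ∈ bad, ¬ τ ⊆ σ) :
    IsStrongDeformationRetract (incl hLK) := by
  classical
  let B : Finset (Finset V) := hfin.toFinset.filter (· ∈ bad)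
  let U : Finset V := hfin.toFinset.biUnion id
  have hB : ∀ τ, τ ∈ B ↔ τ ∈ K.faces ∧ τ ∈ bad := fun τ => by simp [B]
  have hU : ∀ σ ∈ K.faces, σ ⊆ U := fun σ hσ v hv =>
    mem_biUnion.2 ⟨σ, hfin.mem_toFinset.2 hσ, hv⟩
  have spec := push_spec h hU hB
  have hr : ∀ x : K.space, ∃ s ∈ L.faces, (∀ v, push U B w x.wt v ≠ 0 → v ∈ s) ∧
      ∑ v ∈ s, push U B w x.wt v = 1 := fun x => by
    obtain ⟨-, s, hs, hsupp, hsum, hbad⟩ := spec x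
    have hsum' := hsum
    rw [← Finset.sum_filter_ne_zero] at hsum'
    refine ⟨s.filter fun v => push U B w x.wt v ≠ 0, (hL _).2 ⟨?_, fun τ hτ hsub => ?_⟩,
      fun v hv => mem_filter.2 ⟨hsupp v (Or.inr hv), hv⟩, hsum'⟩
    · refine K.down_closed _ hs _ (filter_subset _ _) fun h0 => ?_
      rw [h0, Finset.sum_empty] at hsum'
      exact zero_ne_one hsum'
    · obtain ⟨v, hv, h0⟩ := hbad τ hτ (hne τ hτ)
      exact (mem_filter.1 (hsub hv)).2 h0
  let r : C(K.space, L.space) :=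
    ⟨fun x => space.ofWt (push U B w x.wt) (spec x).1 (hr x),
      space.continuous_mk fun v => (continuous_push U B w v).comp space.continuous_wt⟩
  have hri : ∀ y : L.space, r (incl hLK y) = y := fun y => space.ext_wt fun v => by
    change push U B w y.wt v = y.wt v
    rw [push_eq_self U w y.wt_nonneg fun τ hτ => ?_]
    obtain ⟨s, hs, hsupp⟩ := y.exists_supp_eq
    obtain ⟨u, hu, hus⟩ := Finset.not_subset.1 (((hL s).1 hs).2 τ ((hB τ).1 hτ).2)
    exact ⟨u, hu, not_imp_comm.1 (hsupp u).1 hus⟩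
  obtain ⟨H, hH⟩ := exists_straightLine (ContinuousMap.id K.space) ((incl hLK).comp r) fun x => by
    obtain ⟨-, s, hs, hsupp, -⟩ := spec x
    exact ⟨s, hs, hsupp⟩
  refine ⟨r, ContinuousMap.ext hri, H, fun t y => hH t _ ?_⟩
  change incl hLK y = incl hLK (r (incl hLK y))
  rw [hri]

end Collapse

end AbsSC

/-- `Y`, with the maps `j : X → Y` and `k : ι × A × [0,1] → Y`, is obtained from `X` by attaching,
for every `i : ι`, a cone over `A` along `f (i, ·) : A → X`. -/
structure IsMappingCone {ι A X Y : Type} [TopologicalSpace ι] [TopologicalSpace A]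
    [TopologicalSpace X] [TopologicalSpace Y] (f : C(ι × A, X)) (j : C(X, Y))
    (k : C((ι × A) × unitInterval, Y)) : Prop where
  base : ∀ q, k (q, 1) = j (f q)
  apex : ∀ i a a', k ((i, a), 0) = k ((i, a'), 0)
  surj : ∀ y, (∃ x, j x = y) ∨ ∃ q, k q = y
  desc : ∀ (P : Type) [TopologicalSpace P] (u : C(X, P)) (v : C((ι × A) × unitInterval, P)),
    (∀ q, v (q, 1) = u (f q)) → (∀ i a a', v ((i, a), 0) = v ((i, a'), 0)) →
    ∃ w : C(Y, P), (∀ x, w (j x) = u x) ∧ ∀ q, w (k q) = v q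

namespace IsMappingCone

section Basic

variable {ι A X Y P : Type} [TopologicalSpace ι] [TopologicalSpace A]
  [TopologicalSpace X] [TopologicalSpace Y] [TopologicalSpace P] {f : C(ι × A, X)} {j : C(X, Y)}
  {k : C((ι × A) × unitInterval, Y)}

/-- Homotopies of maps out of a mapping cone can be given piecewise. -/
theorem homotopic (hY : IsMappingCone f j k) (h₀ h₁ : C(Y, P)) (U : C(X × unitInterval, P))
    (V : C(((ι × A) × unitInterval) × unitInterval, P))
    (hbase : ∀ q t, V ((q, 1), t) = U (f q, t))
    (hapex : ∀ i a a' t, V (((i, a), 0), t) = V (((i, a'), 0), t))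
    (hU₀ : ∀ x, U (x, 0) = h₀ (j x)) (hU₁ : ∀ x, U (x, 1) = h₁ (j x))
    (hV₀ : ∀ q, V (q, 0) = h₀ (k q)) (hV₁ : ∀ q, V (q, 1) = h₁ (k q)) :
    h₀.Homotopic h₁ := by
  obtain ⟨w, hwj, hwk⟩ := hY.desc C(unitInterval, P) U.curry V.curry
    (fun q => ContinuousMap.ext fun t => hbase q t)
    (fun i a a' => ContinuousMap.ext fun t => hapex i a a' t)
  refine ⟨⟨w.uncurry.comp ContinuousMap.prodSwap, fun y => ?_, fun y => ?_⟩⟩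
  · change w y 0 = h₀ y
    rcases hY.surj y with ⟨x, rfl⟩ | ⟨q, rfl⟩
    · rw [hwj]; exact hU₀ x
    · rw [hwk]; exact hV₀ q
  · change w y 1 = h₁ y
    rcases hY.surj y with ⟨x, rfl⟩ | ⟨q, rfl⟩
    · rw [hwj]; exact hU₁ x
    · rw [hwk]; exact hV₁ q

/-- The path that runs through the cone over `q` and then along the track of a homotopy. -/
noncomputable def track (j : C(X, Y)) (k : C((ι × A) × unitInterval, Y))
    (G : C((ι × A) × unitInterval, X)) (q : ι × A) (p : ℝ) : Y :=
  if p ≤ 1 then k (q, Set.projIcc 0 1 zero_le_one p)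
  else j (G (q, Set.projIcc 0 1 zero_le_one (p - 1)))

theorem track_of_le {G : C((ι × A) × unitInterval, X)} {q : ι × A} {p : ℝ} (h : p ≤ 1) :
    track j k G q p = k (q, Set.projIcc 0 1 zero_le_one p) := if_pos h

theorem track_of_ge (hY : IsMappingCone f j k) {G : C((ι × A) × unitInterval, X)}
    (hG : ∀ q, G (q, 0) = f q) {q : ι × A} {p : ℝ} (h : 1 ≤ p) :
    track j k G q p = j (G (q, Set.projIcc 0 1 zero_le_one (p - 1))) := by
  rcases h.eq_or_lt with rfl | h
  · rw [track_of_le le_rfl, sub_self, Set.projIcc_right, Set.projIcc_left]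
    exact (hY.base q).trans (congrArg j (hG q).symm)
  · exact if_neg h.not_ge

theorem continuous_track (hY : IsMappingCone f j k) {G : C((ι × A) × unitInterval, X)}
    (hG : ∀ q, G (q, 0) = f q) :
    Continuous fun z : (ι × A) × ℝ => track j k G z.1 z.2 := by
  unfold track
  refine Continuous.if_le ?_ ?_ continuous_snd continuous_const fun z hz => ?_
  · exact k.continuous.comp (continuous_fst.prodMk (continuous_projIcc.comp continuous_snd))
  · exact j.continuous.comp (G.continuous.comp (continuous_fst.prodMk
      (continuous_projIcc.comp (continuous_snd.sub continuous_const))))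
  · rw [hz, sub_self, Set.projIcc_right, Set.projIcc_left]
    exact (hY.base z.1).trans (congrArg j (hG z.1).symm)

end Basic

section Homotopy

variable {ι A X Y Z : Type} [TopologicalSpace ι] [TopologicalSpace A]
  [TopologicalSpace X] [TopologicalSpace Y] [TopologicalSpace Z] {f g : C(ι × A, X)}
  {j : C(X, Y)} {k : C((ι × A) × unitInterval, Y)}
  {j' : C(X, Z)} {k' : C((ι × A) × unitInterval, Z)}

theorem exists_map (hY : IsMappingCone f j k) (hZ : IsMappingCone g j' k')
    {G' : C((ι × A) × unitInterval, X)} (hG₀ : ∀ q, G' (q, 0) = g q)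
    (hG₁ : ∀ q, G' (q, 1) = f q) :
    ∃ φ : C(Y, Z), (∀ x, φ (j x) = j' x) ∧
      ∀ q (s : unitInterval), φ (k (q, s)) = track j' k' G' q (2 * s) := by
  let v : C((ι × A) × unitInterval, Z) := ⟨fun z => track j' k' G' z.1 (2 * z.2),
    (continuous_track hZ hG₀).comp (continuous_fst.prodMk
      (continuous_const.mul (continuous_subtype_val.comp continuous_snd)))⟩
  have hb : ∀ q, v (q, 1) = j' (f q) := fun q => by
    simp only [v, ContinuousMap.coe_mk, Set.Icc.coe_one, mul_one]
    rw [track_of_ge hZ hG₀ one_le_two, show (2 : ℝ) - 1 = 1 by norm_num, Set.projIcc_right]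
    exact congrArg j' (hG₁ q)
  have ha : ∀ i a a', v ((i, a), 0) = v ((i, a'), 0) := fun i a a' => by
    simp only [v, ContinuousMap.coe_mk, Set.Icc.coe_zero, mul_zero]
    rw [track_of_le zero_le_one, track_of_le zero_le_one, Set.projIcc_left]
    exact hZ.apex i a a'
  obtain ⟨φ, h1, h2⟩ := hY.desc Z j' v hb ha
  exact ⟨φ, h1, fun q s => h2 (q, s)⟩

theorem comp_homotopic_id (hY : IsMappingCone f j k) (hZ : IsMappingCone g j' k')
    {G G' : C((ι × A) × unitInterval, X)} (hG₀ : ∀ q, G (q, 0) = f q)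
    (hG₁ : ∀ q, G (q, 1) = g q) (hGG' : ∀ q t, G' (q, t) = G (q, unitInterval.symm t))
    {φ : C(Y, Z)} {ψ : C(Z, Y)} (hφj : ∀ x, φ (j x) = j' x)
    (hφk : ∀ q (s : unitInterval), φ (k (q, s)) = track j' k' G' q (2 * s))
    (hψj : ∀ x, ψ (j' x) = j x)
    (hψk : ∀ q (s : unitInterval), ψ (k' (q, s)) = track j k G q (2 * s)) :
    (ψ.comp φ).Homotopic (ContinuousMap.id Y) := by
  have hG'₀ : ∀ q, G' (q, 0) = g q := fun q => by rw [hGG', unitInterval.symm_zero, hG₁]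
  have key : ∀ q (s : unitInterval),
      ψ (φ (k (q, s))) = track j k G q (min (4 * s) (3 - 2 * s)) := fun q s => by
    rw [hφk]
    rcases le_total (2 * (s : ℝ)) 1 with h | h
    · have hmem : 2 * (s : ℝ) ∈ Set.Icc (0 : ℝ) 1 := ⟨by linarith [s.2.1], h⟩
      rw [track_of_le h, hψk, Set.projIcc_of_mem _ hmem, min_eq_left (by linarith)]
      congr 1
      ring
    · have hmem : 2 * (s : ℝ) - 1 ∈ Set.Icc (0 : ℝ) 1 := ⟨by linarith, by linarith [s.2.2]⟩
      rw [track_of_ge hZ hG'₀ h, hψj, min_eq_right (by linarith),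
        track_of_ge hY hG₀ (by linarith [s.2.2]), hGG']
      congr 3
      rw [Set.projIcc_of_mem _ hmem,
        Set.projIcc_of_mem _ (show 3 - 2 * (s : ℝ) - 1 ∈ Set.Icc (0 : ℝ) 1 from
          ⟨by linarith [s.2.2], by linarith⟩)]
      apply Subtype.ext
      change 1 - (2 * (s : ℝ) - 1) = _
      ring
  refine hY.homotopic _ _ (j.comp ContinuousMap.fst)
    ⟨fun z => track j k G z.1.1
      ((1 - (z.2 : ℝ)) * min (4 * (z.1.2 : ℝ)) (3 - 2 * (z.1.2 : ℝ)) + z.2 * z.1.2), ?_⟩ ?_ ?_ ?_ ?_ ?_ ?_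
  · refine (continuous_track hY hG₀).comp ((continuous_fst.comp continuous_fst).prodMk ?_)
    fun_prop
  · intro q t
    simp only [ContinuousMap.coe_mk, Set.Icc.coe_one, ContinuousMap.comp_apply]
    rw [show (1 - (t : ℝ)) * min (4 * 1) (3 - 2 * 1) + t * 1 = 1 by
      rw [min_eq_right (by norm_num)]; ring, track_of_le le_rfl, Set.projIcc_right]
    exact hY.base q
  · intro i a a' t
    simp only [ContinuousMap.coe_mk, Set.Icc.coe_zero]
    rw [show (1 - (t : ℝ)) * min (4 * 0) (3 - 2 * 0) + t * 0 = 0 by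
      rw [min_eq_left (by norm_num)]; ring, track_of_le zero_le_one, track_of_le zero_le_one,
      Set.projIcc_left]
    exact hY.apex i a a'
  · intro x
    simp [hφj, hψj]
  · intro x
    simp
  · rintro ⟨q, s⟩
    simp only [ContinuousMap.coe_mk, Set.Icc.coe_zero, ContinuousMap.comp_apply, key]
    congr 1
    ring
  · rintro ⟨q, s⟩
    simp only [ContinuousMap.coe_mk, Set.Icc.coe_one, ContinuousMap.id_apply]
    rw [show (1 - (1 : ℝ)) * min (4 * (s : ℝ)) (3 - 2 * s) + 1 * s = s by ring,
      track_of_le s.2.2, Set.projIcc_val]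

/-- Mapping cones of homotopic maps are homotopy equivalent. -/
theorem nonempty_homotopyEquiv (hY : IsMappingCone f j k) (hZ : IsMappingCone g j' k')
    (hfg : f.Homotopic g) : Nonempty (ContinuousMap.HomotopyEquiv Y Z) := by
  obtain ⟨H⟩ := hfg
  let G : C((ι × A) × unitInterval, X) := H.toContinuousMap.comp ContinuousMap.prodSwap
  let G' : C((ι × A) × unitInterval, X) := H.symm.toContinuousMap.comp ContinuousMap.prodSwap
  have hG₀ : ∀ q, G (q, 0) = f q := H.apply_zero
  have hG₁ : ∀ q, G (q, 1) = g q := H.apply_one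
  have hG'₀ : ∀ q, G' (q, 0) = g q := H.symm.apply_zero
  have hG'₁ : ∀ q, G' (q, 1) = f q := H.symm.apply_one
  have hGG' : ∀ q t, G' (q, t) = G (q, unitInterval.symm t) := fun q t => H.symm_apply (t, q)
  obtain ⟨φ, hφj, hφk⟩ := exists_map hY hZ hG'₀ hG'₁
  obtain ⟨ψ, hψj, hψk⟩ := exists_map hZ hY hG₀ hG₁
  exact ⟨⟨φ, ψ, comp_homotopic_id hY hZ hG₀ hG₁ hGG' hφj hφk hψj hψk,
    comp_homotopic_id hZ hY hG'₀ hG'₁ (fun q t => by rw [hGG', unitInterval.symm_symm])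
      hψj hψk hφj hφk⟩⟩

end Homotopy

section Retract

variable {ι A X X' Y Z : Type} [TopologicalSpace ι] [TopologicalSpace A]
  [TopologicalSpace X] [TopologicalSpace X'] [TopologicalSpace Y] [TopologicalSpace Z]
  {j : C(X, Y)} {k : C((ι × A) × unitInterval, Y)}
  {j' : C(X', Z)} {k' : C((ι × A) × unitInterval, Z)}

/-- A mapping cone of a constant map does not change up to homotopy when the base space is
replaced by a strong deformation retract that contains the value of that map. -/
theorem nonempty_homotopyEquiv_of_retract {i : C(X', X)} (hi : IsStrongDeformationRetract i)
    {x' : X'} (hY : IsMappingCone (ContinuousMap.const (ι × A) (i x')) j k)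
    (hZ : IsMappingCone (ContinuousMap.const (ι × A) x') j' k') :
    Nonempty (ContinuousMap.HomotopyEquiv Y Z) := by
  obtain ⟨r, hri, H, hH⟩ := hi
  have hri' : ∀ x, r (i x) = x := fun x => DFunLike.congr_fun hri x
  obtain ⟨φ, hφj, hφk⟩ := hY.desc Z (j'.comp r) k'
    (fun q => (hZ.base q).trans (congrArg j' (hri' x').symm)) hZ.apex
  obtain ⟨ψ, hψj, hψk⟩ := hZ.desc Y (j.comp i) k hY.base hY.apex
  refine ⟨⟨φ, ψ, ContinuousMap.Homotopic.symm ?_, ?_⟩⟩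
  · refine hY.homotopic _ _ (j.comp (H.toContinuousMap.comp ContinuousMap.prodSwap))
      (k.comp ContinuousMap.fst) (fun q t => ?_) (fun i a a' _ => hY.apex i a a') (fun x => ?_)
      (fun x => ?_) (fun q => ?_) fun q => ?_
    · exact (hY.base q).trans (congrArg j (hH t x').symm)
    · exact congrArg j (H.apply_zero x)
    · exact (congrArg j (H.apply_one x)).trans ((hψj _).symm.trans (congrArg ψ (hφj x).symm))
    · rfl
    · exact (hψk q).symm.trans (congrArg ψ (hφk q).symm)
  · have : φ.comp ψ = ContinuousMap.id Z := by
      ext z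
      rcases hZ.surj z with ⟨x, rfl⟩ | ⟨q, rfl⟩
      · simp [hψj, hφj, hri']
      · simp [hψk, hφk]
    rw [this]

end Retract

end IsMappingCone

/-- The boundary of the standard triangle. -/
abbrev TriangleBoundary : Type := {a : Fin 3 → ℝ // a ∈ stdSimplex ℝ (Fin 3) ∧ ∃ i, a i = 0}

namespace TriangleBoundary

theorem nonneg (a : TriangleBoundary) (i : Fin 3) : 0 ≤ a.1 i := a.2.1.1 i

theorem sum_eq_one (a : TriangleBoundary) : a.1 0 + a.1 1 + a.1 2 = 1 := by
  rw [← a.2.1.2, Fin.sum_univ_three]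

instance : CompactSpace TriangleBoundary := by
  have h : IsClosed (⋃ i, {a : Fin 3 → ℝ | a i = 0}) :=
    isClosed_iUnion_of_finite fun i => isClosed_eq (continuous_apply i) continuous_const
  have h' := (isCompact_stdSimplex ℝ (Fin 3)).inter_right h
  rw [← Set.ofPred_exists] at h'
  exact isCompact_iff_compactSpace.1 h'

theorem continuous_coord (i : Fin 3) : Continuous fun a : TriangleBoundary => a.1 i :=
  (continuous_apply i).comp continuous_subtype_val

/-- The distance to the barycenter, in the last two coordinates. -/
noncomputable def radius (a : TriangleBoundary) : ℝ :=
  Real.sqrt ((a.1 1 - 1 / 3) ^ 2 + (a.1 2 - 1 / 3) ^ 2)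

theorem sq_add_sq_pos (a : TriangleBoundary) :
    0 < (a.1 1 - 1 / 3) ^ 2 + (a.1 2 - 1 / 3) ^ 2 := by
  have hs := a.sum_eq_one
  obtain ⟨i, hi⟩ := a.2.2
  by_contra! hcon
  have h1 : a.1 1 - 1 / 3 = 0 := by nlinarith [sq_nonneg (a.1 1 - 1 / 3), sq_nonneg (a.1 2 - 1 / 3)]
  have h2 : a.1 2 - 1 / 3 = 0 := by nlinarith [sq_nonneg (a.1 1 - 1 / 3), sq_nonneg (a.1 2 - 1 / 3)]
  fin_cases i <;> simp only [Fin.zero_eta, Fin.mk_one, Fin.reduceFinMk] at hi <;> linarith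

theorem radius_pos (a : TriangleBoundary) : 0 < a.radius := Real.sqrt_pos.2 a.sq_add_sq_pos

theorem radius_sq (a : TriangleBoundary) :
    a.radius ^ 2 = (a.1 1 - 1 / 3) ^ 2 + (a.1 2 - 1 / 3) ^ 2 := Real.sq_sqrt a.sq_add_sq_pos.le

theorem continuous_radius : Continuous radius :=
  Real.continuous_sqrt.comp ((((continuous_coord 1).sub continuous_const).pow 2).add
    (((continuous_coord 2).sub continuous_const).pow 2))

theorem continuous_direction (i : Fin 3) :
    Continuous fun a : TriangleBoundary => (a.1 i - 1 / 3) / a.radius :=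
  ((continuous_coord i).sub continuous_const).div continuous_radius fun a => a.radius_pos.ne'

theorem le_one_of_eq_mul {a b : TriangleBoundary} {c : ℝ}
    (h : ∀ i, b.1 i - 1 / 3 = c * (a.1 i - 1 / 3)) : c ≤ 1 := by
  obtain ⟨i, hi⟩ := a.2.2
  have := h i
  rw [hi] at this
  linarith [b.nonneg i]

theorem eq_of_eq_mul {a b : TriangleBoundary} {c : ℝ} (hc : 0 < c)
    (h : ∀ i, b.1 i - 1 / 3 = c * (a.1 i - 1 / 3)) : a = b := by
  have h1 : c ≤ 1 := le_one_of_eq_mul h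
  have h2 : c⁻¹ ≤ 1 := le_one_of_eq_mul (a := b) (b := a) fun i => by
    rw [h i, inv_mul_cancel_left₀ hc.ne']
  have : c = 1 := le_antisymm h1 ((inv_le_one₀ hc).1 h2)
  refine Subtype.ext (funext fun i => ?_)
  have := h i
  subst c
  linarith

theorem eq_of_direction_eq {a b : TriangleBoundary}
    (h1 : (a.1 1 - 1 / 3) / a.radius = (b.1 1 - 1 / 3) / b.radius)
    (h2 : (a.1 2 - 1 / 3) / a.radius = (b.1 2 - 1 / 3) / b.radius) : a = b := by
  have ha := a.radius_pos
  have hb := b.radius_pos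
  have e1 : b.1 1 - 1 / 3 = b.radius / a.radius * (a.1 1 - 1 / 3) := by
    rw [div_eq_iff ha.ne'] at h1; rw [h1]; field_simp
  have e2 : b.1 2 - 1 / 3 = b.radius / a.radius * (a.1 2 - 1 / 3) := by
    rw [div_eq_iff ha.ne'] at h2; rw [h2]; field_simp
  refine eq_of_eq_mul (div_pos hb ha) fun i => ?_
  fin_cases i
  · have s1 := a.sum_eq_one
    have s2 := b.sum_eq_one
    simp only [Fin.zero_eta]
    rw [show a.1 0 - 1 / 3 = -(a.1 1 - 1 / 3) - (a.1 2 - 1 / 3) by linarith, mul_sub, mul_neg,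
      ← e1, ← e2]
    linarith
  · exact e1
  · exact e2

theorem exists_eq_mul {x y : ℝ} (h : x ^ 2 + y ^ 2 ≠ 0) :
    ∃ a : TriangleBoundary, ∃ c > 0, a.1 1 - 1 / 3 = c * x ∧ a.1 2 - 1 / 3 = c * y := by
  let v : Fin 3 → ℝ := ![-(x + y), x, y]
  have hv : v 0 + v 1 + v 2 = 0 := by simp [v]
  obtain ⟨i, hi⟩ := Finite.exists_min v
  have hneg : v i < 0 := by
    by_contra! hcon
    have h0 := hcon.trans (hi 0)
    have h1 := hcon.trans (hi 1)
    have h2 := hcon.trans (hi 2)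
    have hx : x = 0 := by change v 1 = 0; linarith
    have hy : y = 0 := by change v 2 = 0; linarith
    simp [hx, hy] at h
  have hpos : 0 < -3 * v i := by linarith
  refine ⟨⟨fun j => 1 / 3 + v j / (-3 * v i), ⟨fun j => ?_, ?_⟩, i, ?_⟩, (-3 * v i)⁻¹,
    inv_pos.2 hpos, ?_, ?_⟩
  · have : -1 / 3 ≤ v j / (-3 * v i) := by
      rw [le_div_iff₀ hpos]
      linarith [hi j]
    change 0 ≤ 1 / 3 + v j / (-3 * v i)
    linarith
  · rw [Fin.sum_univ_three]
    have : v 0 / (-3 * v i) + v 1 / (-3 * v i) + v 2 / (-3 * v i) = 0 := by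
      rw [← add_div, ← add_div, hv, zero_div]
    linarith
  · change 1 / 3 + v i / (-3 * v i) = 0
    field_simp [hneg.ne]
    norm_num
  · change 1 / 3 + x / (-3 * v i) - 1 / 3 = _
    ring
  · change 1 / 3 + y / (-3 * v i) - 1 / 3 = _
    ring

/-- The cone over the boundary of the triangle, wrapped around the sphere with the base of the
cone sent to the base point. -/
noncomputable def toSphere (z : TriangleBoundary × unitInterval) : Sph 2 :=
  ⟨!₂[2 * (z.2 : ℝ) - 1,
    2 * Real.sqrt (z.2 * (1 - z.2)) * ((z.1.1 1 - 1 / 3) / z.1.radius),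
    2 * Real.sqrt (z.2 * (1 - z.2)) * ((z.1.1 2 - 1 / 3) / z.1.radius)], by
    rw [mem_sphere_zero_iff_norm, EuclideanSpace.norm_eq, Real.sqrt_eq_one, Fin.sum_univ_three]
    have h1 := Real.sq_sqrt (mul_nonneg z.2.2.1 (sub_nonneg.2 z.2.2.2))
    have h2 : ((z.1.1 1 - 1 / 3) / z.1.radius) ^ 2 + ((z.1.1 2 - 1 / 3) / z.1.radius) ^ 2 = 1 := by
      rw [div_pow, div_pow, ← add_div, ← radius_sq, div_self (pow_pos z.1.radius_pos 2).ne']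
    simp only [Real.norm_eq_abs, sq_abs, Matrix.cons_val_zero,
      Matrix.cons_val_one, Matrix.cons_val]
    rw [mul_pow _ (_ / _), mul_pow _ (_ / _), add_assoc, ← mul_add, h2, mul_pow, h1]
    ring⟩

theorem toSphere_val (a : TriangleBoundary) (s : unitInterval) : (toSphere (a, s)).1 =
    !₂[2 * (s : ℝ) - 1, 2 * Real.sqrt (s * (1 - s)) * ((a.1 1 - 1 / 3) / a.radius),
      2 * Real.sqrt (s * (1 - s)) * ((a.1 2 - 1 / 3) / a.radius)] := rfl

theorem continuous_toSphere : Continuous toSphere := by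
  refine Continuous.subtype_mk ((PiLp.continuous_toLp 2 _).comp (continuous_pi fun i => ?_)) _
  have hs : Continuous fun z : TriangleBoundary × unitInterval =>
      2 * Real.sqrt (z.2 * (1 - z.2)) := by fun_prop
  fin_cases i
  · change Continuous fun z : TriangleBoundary × unitInterval => 2 * (z.2 : ℝ) - 1
    fun_prop
  · exact hs.mul ((continuous_direction 1).comp continuous_fst)
  · exact hs.mul ((continuous_direction 2).comp continuous_fst)

theorem toSphere_one (a : TriangleBoundary) : toSphere (a, 1) = sphBase 2 := by
  refine Subtype.ext ?_
  rw [toSphere_val]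
  ext i
  fin_cases i
  · simp [sphBase]
    norm_num
  · simp [sphBase]
  · simp [sphBase]

theorem toSphere_zero (a b : TriangleBoundary) : toSphere (a, 0) = toSphere (b, 0) := by
  refine Subtype.ext ?_
  rw [toSphere_val, toSphere_val]
  simp

theorem toSphere_eq {z z' : TriangleBoundary × unitInterval} (h : toSphere z = toSphere z') :
    z = z' ∨ z.2 = z'.2 ∧ (z.2 = 0 ∨ z.2 = 1) := by
  obtain ⟨a, s⟩ := z
  obtain ⟨b, t⟩ := z'
  have h' := congrArg Subtype.val h
  rw [toSphere_val, toSphere_val] at h'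
  have e0 := congrArg (fun u : EuclideanSpace ℝ (Fin 3) => u 0) h'
  have e1 := congrArg (fun u : EuclideanSpace ℝ (Fin 3) => u 1) h'
  have e2 := congrArg (fun u : EuclideanSpace ℝ (Fin 3) => u 2) h'
  simp only [Matrix.cons_val_zero, Matrix.cons_val_one, Matrix.cons_val]
    at e0 e1 e2
  obtain rfl : s = t := Subtype.ext (by linarith)
  rcases eq_or_ne (s : ℝ) 0 with hs | hs
  · exact Or.inr ⟨rfl, Or.inl (Subtype.ext hs)⟩
  rcases eq_or_ne (s : ℝ) 1 with hs' | hs'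
  · exact Or.inr ⟨rfl, Or.inr (Subtype.ext hs')⟩
  have hpos : 0 < 2 * Real.sqrt (s * (1 - s)) := mul_pos two_pos (Real.sqrt_pos.2
    (mul_pos (lt_of_le_of_ne s.2.1 hs.symm) (sub_pos.2 (lt_of_le_of_ne s.2.2 hs'))))
  exact Or.inl (Prod.ext (eq_of_direction_eq (mul_left_cancel₀ hpos.ne' e1)
    (mul_left_cancel₀ hpos.ne' e2)) rfl)

theorem toSphere_surjective : Function.Surjective toSphere := by
  rintro ⟨u, hu⟩
  rw [mem_sphere_zero_iff_norm, EuclideanSpace.norm_eq, Real.sqrt_eq_one, Fin.sum_univ_three] at hu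
  simp only [Real.norm_eq_abs, sq_abs] at hu
  have hle : |u 0| ≤ 1 := by
    rw [← sq_le_one_iff_abs_le_one]
    nlinarith [sq_nonneg (u 1), sq_nonneg (u 2)]
  rw [abs_le] at hle
  let s : unitInterval := ⟨(u 0 + 1) / 2, by linarith, by linarith⟩
  have hs : 2 * Real.sqrt (s * (1 - s)) = Real.sqrt (u 1 ^ 2 + u 2 ^ 2) := by
    rw [show (s : ℝ) * (1 - s) = (u 1 ^ 2 + u 2 ^ 2) / 2 ^ 2 by
      change (u 0 + 1) / 2 * (1 - (u 0 + 1) / 2) = _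
      linear_combination (-1 / 4) * hu, Real.sqrt_div' _ (by positivity), Real.sqrt_sq two_pos.le]
    ring
  have key : ∃ a : TriangleBoundary,
      Real.sqrt (u 1 ^ 2 + u 2 ^ 2) * ((a.1 1 - 1 / 3) / a.radius) = u 1 ∧
      Real.sqrt (u 1 ^ 2 + u 2 ^ 2) * ((a.1 2 - 1 / 3) / a.radius) = u 2 := by
    by_cases h : u 1 ^ 2 + u 2 ^ 2 = 0
    · have e1 : u 1 = 0 := by nlinarith [sq_nonneg (u 1), sq_nonneg (u 2)]
      have e2 : u 2 = 0 := by nlinarith [sq_nonneg (u 1), sq_nonneg (u 2)]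
      obtain ⟨a, -⟩ := exists_eq_mul (x := 1) (y := 0) (by norm_num)
      exact ⟨a, by simp [e1, e2]⟩
    · obtain ⟨a, c, hc, h1, h2⟩ := exists_eq_mul h
      have hr : a.radius = c * Real.sqrt (u 1 ^ 2 + u 2 ^ 2) := by
        rw [radius, h1, h2, mul_pow, mul_pow, ← mul_add, Real.sqrt_mul' _ (by positivity),
          Real.sqrt_sq hc.le]
      have hp : Real.sqrt (u 1 ^ 2 + u 2 ^ 2) ≠ 0 :=
        (Real.sqrt_pos.2 (lt_of_le_of_ne (by positivity) (Ne.symm h))).ne'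
      refine ⟨a, ?_, ?_⟩
      · rw [h1, hr]; field_simp
      · rw [h2, hr]; field_simp
  obtain ⟨a, h1, h2⟩ := key
  refine ⟨(a, s), Subtype.ext ?_⟩
  rw [toSphere_val, hs, h1, h2]
  ext i
  fin_cases i
  · simp [s]
    ring
  · simp
  · simp

end TriangleBoundary

section Wedge

open TriangleBoundary

variable {N : ℕ} {X : Type} [TopologicalSpace X]

/-- The inclusion of the second summand of a wedge of spheres with a space. -/
def wedgeBase (N : ℕ) (x : X) :
    C(X, Wedge2 (WedgeSph 2 N) X (wedgeSphPt 2 N) x) :=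
  ⟨fun y => Quot.mk _ (Sum.inr y), continuous_quot_mk.comp continuous_inr⟩

/-- The spheres in a wedge of spheres with a space, parametrized by cones. -/
noncomputable def wedgeCone (N : ℕ) (x : X) : C((Fin N × TriangleBoundary) × unitInterval,
    Wedge2 (WedgeSph 2 N) X (wedgeSphPt 2 N) x) :=
  ⟨fun z => Quot.mk _ (Sum.inl (Quot.mk _ (Sum.inr (z.1.1, toSphere (z.1.2, z.2))))),
    continuous_quot_mk.comp (continuous_inl.comp (continuous_quot_mk.comp (continuous_inr.comp
      ((continuous_fst.comp continuous_fst).prodMk (continuous_toSphere.comp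
        ((continuous_snd.comp continuous_fst).prodMk continuous_snd))))))⟩

/-- A wedge of spheres with a space is a mapping cone of a constant map. -/
theorem isMappingCone_wedge (N : ℕ) (x : X) :
    IsMappingCone (ContinuousMap.const (Fin N × TriangleBoundary) x) (wedgeBase N x)
      (wedgeCone N x) where
  base q := by
    change Quot.mk _ (Sum.inl (Quot.mk _ (Sum.inr (q.1, toSphere (q.2, 1))))) = _
    rw [toSphere_one]
    refine Eq.trans ?_ (Quot.sound wedge2Rel.glue)
    exact congrArg (fun u : WedgeSph 2 N => Quot.mk _ (Sum.inl u))
      (Quot.sound (wedgeRel.glue q.1)).symm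
  apex i a a' := by
    change Quot.mk _ (Sum.inl (Quot.mk _ (Sum.inr (i, toSphere (a, 0))))) = _
    rw [toSphere_zero a a']
    rfl
  surj y := by
    obtain ⟨u | y, rfl⟩ := Quot.exists_rep y
    · obtain ⟨_ | ⟨i, p⟩, rfl⟩ := Quot.exists_rep u
      · exact Or.inl ⟨x, (Quot.sound wedge2Rel.glue).symm⟩
      · obtain ⟨⟨a, s⟩, rfl⟩ := toSphere_surjective p
        exact Or.inr ⟨((i, a), s), rfl⟩
    · exact Or.inl ⟨y, rfl⟩
  desc P _ u v hb ha := by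
    let π : C((Fin N × TriangleBoundary) × unitInterval, Fin N × Sph 2) :=
      ⟨fun z => (z.1.1, toSphere (z.1.2, z.2)),
        (continuous_fst.comp continuous_fst).prodMk (continuous_toSphere.comp
        ((continuous_snd.comp continuous_fst).prodMk continuous_snd))⟩
    have hπ : Topology.IsQuotientMap π := by
      refine (π.continuous.isClosedMap).isQuotientMap π.continuous ?_
      rintro ⟨i, p⟩
      obtain ⟨⟨a, s⟩, rfl⟩ := toSphere_surjective p
      exact ⟨((i, a), s), rfl⟩
    have hv : Function.FactorsThrough v π := by
      rintro ⟨⟨i, a⟩, s⟩ ⟨⟨i', a'⟩, s'⟩ h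
      obtain rfl : i = i' := congrArg Prod.fst h
      rcases toSphere_eq (congrArg Prod.snd h) with h | ⟨h, h' | h'⟩
      · obtain ⟨rfl, rfl⟩ := Prod.ext_iff.1 h
        rfl
      · obtain rfl : s = s' := h
        obtain rfl : s = 0 := h'
        exact ha i a a'
      · obtain rfl : s = s' := h
        obtain rfl : s = 1 := h'
        exact (hb (i, a)).trans (hb (i, a')).symm
    let V : C(Fin N × Sph 2, P) := hπ.lift v hv
    have hV : ∀ z, V (π z) = v z := fun z => DFunLike.congr_fun (hπ.lift_comp v hv) z
    have hVb : ∀ i, V (i, sphBase 2) = u x := fun i => by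
      obtain ⟨a, -⟩ := exists_eq_mul (x := 1) (y := 0) (by norm_num)
      rw [← toSphere_one a]
      exact (hV ((i, a), 1)).trans (hb _)
    let W₁ : C(WedgeSph 2 N, P) :=
      ⟨Quot.lift (Sum.elim (fun _ => u x) V) (by rintro _ _ ⟨i⟩; exact (hVb i).symm),
        continuous_quot_lift _ (continuous_const.sumElim V.continuous)⟩
    refine ⟨⟨Quot.lift (Sum.elim W₁ u) (by rintro _ _ ⟨⟩; rfl),
      continuous_quot_lift _ (W₁.continuous.sumElim u.continuous)⟩, fun _ => rfl, fun q => hV q⟩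

end Wedge

namespace AbsSC

section Comb

variable {V κ P : Type} [DecidableEq V] [Fintype κ] [TopologicalSpace P] {K : AbsSC V}

/-- The convex combination of the vertices `p k` with weights `c k`. -/
noncomputable def space.comb (p : κ → V) (c : κ → ℝ) (h0 : ∀ k, 0 ≤ c k) (h1 : ∑ k, c k = 1)
    (h : ∃ s ∈ K.faces, ∀ k, c k ≠ 0 → p k ∈ s) : K.space :=
  space.ofWt (fun v => ∑ k, if p k = v then c k else 0)
    (fun v => Finset.sum_nonneg fun k _ => by split_ifs; exacts [h0 k, le_rfl]) (by
    obtain ⟨s, hs, hk⟩ := h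
    refine ⟨s, hs, fun v hv => ?_, ?_⟩
    · obtain ⟨k, -, hk'⟩ := Finset.exists_ne_zero_of_sum_ne_zero hv
      rw [ite_ne_right_iff] at hk'
      exact hk'.1 ▸ hk k hk'.2
    · rw [Finset.sum_comm, ← h1]
      refine Finset.sum_congr rfl fun k _ => ?_
      rw [Finset.sum_ite_eq]
      split_ifs with hks
      · rfl
      · exact (not_imp_comm.1 (hk k) hks).symm)

theorem space.wt_comb {p : κ → V} {c : κ → ℝ} {h0 : ∀ k, 0 ≤ c k} {h1 : ∑ k, c k = 1}
    {h : ∃ s ∈ K.faces, ∀ k, c k ≠ 0 → p k ∈ s} (v : V) :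
    (space.comb p c h0 h1 h).wt v = ∑ k, if p k = v then c k else 0 := rfl

theorem exists_of_sum_ite_ne_zero {p : κ → V} {c : κ → ℝ} {v : V}
    (hv : (∑ k, if p k = v then c k else 0) ≠ 0) : ∃ k, c k ≠ 0 ∧ p k = v := by
  obtain ⟨k, -, hk⟩ := Finset.exists_ne_zero_of_sum_ne_zero hv
  rw [ite_ne_right_iff] at hk
  exact ⟨k, hk.2, hk.1⟩

/-- A family of convex combinations of fixed vertices. -/
noncomputable def combMap (p : κ → V) (c : P → κ → ℝ) (h0 : ∀ x k, 0 ≤ c x k)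
    (h1 : ∀ x, ∑ k, c x k = 1) (h : ∀ x, ∃ s ∈ K.faces, ∀ k, c x k ≠ 0 → p k ∈ s)
    (hc : ∀ k, Continuous fun x => c x k) : C(P, K.space) where
  toFun x := space.comb p (c x) (h0 x) (h1 x) (h x)
  continuous_toFun := space.continuous_mk fun v => by
    simp only [space.wt_comb]
    refine continuous_finsetSum _ fun k _ => ?_
    split_ifs
    exacts [hc k, continuous_const]

/-- A vertex, as a point of the realization. -/
noncomputable def space.vertex (v : V) (hv : {v} ∈ K.faces) : K.space :=
  space.comb (fun _ : Unit => v) (fun _ => 1) (fun _ => zero_le_one) (by simp)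
    ⟨{v}, hv, fun _ _ => mem_singleton_self v⟩

theorem space.eq_of_wt_vertex_ne_zero {v w : V} {hv : {v} ∈ K.faces}
    (h : (space.vertex v hv).wt w ≠ 0) : w = v := by
  obtain ⟨_, -, h⟩ : ∃ _ : Unit, (1 : ℝ) ≠ 0 ∧ v = w := exists_of_sum_ite_ne_zero h
  exact h.symm

theorem const_vertex_homotopic (P : Type) [TopologicalSpace P] {v w : V} (hv : {v} ∈ K.faces)
    (hw : {w} ∈ K.faces) (h : {v, w} ∈ K.faces) :
    (ContinuousMap.const P (space.vertex v hv)).Homotopic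
      (ContinuousMap.const P (space.vertex w hw)) := by
  obtain ⟨H, -⟩ := exists_straightLine (ContinuousMap.const P (space.vertex v hv))
    (ContinuousMap.const P (space.vertex w hw)) fun _ => ⟨{v, w}, h, fun u hu => by
      rcases hu with hu | hu
      · obtain rfl : u = v := space.eq_of_wt_vertex_ne_zero (hv := hv) hu
        simp
      · obtain rfl : u = w := space.eq_of_wt_vertex_ne_zero (hv := hw) hu
        simp⟩
  exact ⟨H⟩

end Comb

section Nullhomotopy

/-- What remains of the coordinate `j` after both coordinates of every edge have been
decreased by their minimum. -/
def residue (a : Fin 3 → ℝ) (j : Fin 3) : ℝ :=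
  a j - min (a j) (a (j + 1)) - min (a j) (a (j + 2))

theorem eq_add_one_or_eq_add_two {i k : Fin 3} (h : k ≠ i) : k = i + 1 ∨ k = i + 2 := by
  decide +revert

theorem exists_residue (a : TriangleBoundary) : ∃ i j : Fin 3, j ≠ i ∧ a.1 i = 0 ∧
    0 ≤ residue a.1 j ∧ (∀ k, k ≠ j → residue a.1 k = 0) ∧
    ∀ k, k ≠ i → min (a.1 (k + 1)) (a.1 (k + 2)) = 0 := by
  obtain ⟨i, hi⟩ := a.2.2
  have h0 := a.nonneg 0
  have h1 := a.nonneg 1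
  have h2 := a.nonneg 2
  rcases le_total (a.1 (i + 1)) (a.1 (i + 2)) with h | h
  · refine ⟨i, i + 2, (by decide : ∀ i : Fin 3, i + 2 ≠ i) i, hi, ?_⟩
    fin_cases i <;> simp [residue, Fin.forall_fin_succ] at * <;> simp_all
  · refine ⟨i, i + 1, (by decide : ∀ i : Fin 3, i + 1 ≠ i) i, hi, ?_⟩
    fin_cases i <;> simp [residue, Fin.forall_fin_succ] at * <;> simp_all

variable {V : Type} [DecidableEq V] {K : AbsSC V}

theorem exists_boundary_face {p : Fin 3 → V} (hp : ∀ k, {p (k + 1), p (k + 2)} ∈ K.faces)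
    (a : TriangleBoundary) : ∃ s ∈ K.faces, ∀ k, a.1 k ≠ 0 → p k ∈ s := by
  obtain ⟨i, hi⟩ := a.2.2
  refine ⟨_, hp i, fun k hk => ?_⟩
  rcases eq_add_one_or_eq_add_two (i := i) (k := k) (by rintro rfl; exact hk hi) with rfl | rfl <;>
    simp

/-- The boundary of a triangle, mapped affinely on every edge. -/
noncomputable def boundaryMap (p : Fin 3 → V) (hp : ∀ k, {p (k + 1), p (k + 2)} ∈ K.faces) :
    C(TriangleBoundary, K.space) :=
  combMap p (fun a => a.1) TriangleBoundary.nonneg (fun a => a.2.1.2) (exists_boundary_face hp)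
    TriangleBoundary.continuous_coord

theorem exists_of_wt_boundaryMap_ne_zero {p : Fin 3 → V}
    {hp : ∀ k, {p (k + 1), p (k + 2)} ∈ K.faces} {a : TriangleBoundary} {v : V}
    (h : (boundaryMap p hp a).wt v ≠ 0) : ∃ k, a.1 k ≠ 0 ∧ p k = v :=
  exists_of_sum_ite_ne_zero h

/-- The boundary of a triangle is null-homotopic if it is filled by an octahedron with one
triangle missing. -/
theorem boundaryMap_homotopic_const (p W : Fin 3 → V)
    (hp : ∀ k, {p (k + 1), p (k + 2)} ∈ K.faces)
    (hpW : ∀ k, {p (k + 1), p (k + 2), W k} ∈ K.faces)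
    (hWp : ∀ k, {p k, W (k + 1), W (k + 2)} ∈ K.faces)
    (hW : {W 0, W 1, W 2} ∈ K.faces) (h0 : {W 0} ∈ K.faces) :
    (boundaryMap p hp).Homotopic (ContinuousMap.const _ (space.vertex (W 0) h0)) := by
  have hcont := TriangleBoundary.continuous_coord
  have hmin : ∀ (a : TriangleBoundary) (i j : Fin 3), 0 ≤ min (a.1 i) (a.1 j) := fun a i j =>
    le_min (a.nonneg i) (a.nonneg j)
  have hres : ∀ (a : TriangleBoundary) (k : Fin 3), 0 ≤ residue a.1 k := fun a k => by
    obtain ⟨i, j, -, -, hj, h, -⟩ := exists_residue a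
    by_cases hk : k = j
    · exact hk ▸ hj
    · exact (h k hk).ge
  have hrescont : ∀ k, Continuous fun a : TriangleBoundary => residue a.1 k := fun k =>
    ((hcont k).sub ((hcont k).min (hcont _))).sub ((hcont k).min (hcont _))
  have hmincont : ∀ k : Fin 3,
      Continuous fun a : TriangleBoundary => 2 * min (a.1 (k + 1)) (a.1 (k + 2)) := fun k =>
    continuous_const.mul ((hcont _).min (hcont _))
  let g : C(TriangleBoundary, K.space) := combMap (Sum.elim p W)
    (fun a => Sum.elim (residue a.1) fun k => 2 * min (a.1 (k + 1)) (a.1 (k + 2)))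
    (by rintro a (k | k); exacts [hres a k, mul_nonneg two_pos.le (hmin a _ _)])
    (fun a => by
      have := a.sum_eq_one
      simp only [Fintype.sum_sum_type, Sum.elim_inl, Sum.elim_inr, Fin.sum_univ_three, residue,
        Fin.reduceAdd, zero_add, Fin.isValue]
      rw [min_comm (a.1 1) (a.1 0), min_comm (a.1 2) (a.1 0), min_comm (a.1 2) (a.1 1)]
      linarith)
    (fun a => by
      obtain ⟨i, j, hji, hi, hj, hk, hk'⟩ := exists_residue a
      refine ⟨_, hpW i, ?_⟩
      rintro (k | k) h
      · obtain rfl : k = j := not_imp_comm.1 (hk k) h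
        rcases eq_add_one_or_eq_add_two hji with rfl | rfl <;> simp
      · obtain rfl : k = i := not_imp_comm.1 (hk' k) fun h' => h (by simp [h'])
        simp)
    (by rintro (k | k); exacts [hrescont k, hmincont k])
  let e : C(TriangleBoundary, K.space) := combMap W
    (fun a k => 2 * min (a.1 (k + 1)) (a.1 (k + 2)) + residue a.1 (k + 2))
    (fun a k => add_nonneg (mul_nonneg two_pos.le (hmin a _ _)) (hres a _))
    (fun a => by
      have := a.sum_eq_one
      simp only [Fin.sum_univ_three, residue, Fin.reduceAdd, zero_add, Fin.isValue]
      rw [min_comm (a.1 1) (a.1 0), min_comm (a.1 2) (a.1 0), min_comm (a.1 2) (a.1 1)]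
      linarith)
    (fun a => ⟨_, hW, fun k _ => by fin_cases k <;> simp⟩)
    (fun k => (hmincont k).add (hrescont _))
  have hg : ∀ a v, (g a).wt v ≠ 0 → ∃ k, Sum.elim (residue a.1)
      (fun k => 2 * min (a.1 (k + 1)) (a.1 (k + 2))) k ≠ 0 ∧ Sum.elim p W k = v :=
    fun a v h => exists_of_sum_ite_ne_zero h
  have he : ∀ a v, (e a).wt v ≠ 0 →
      ∃ k, 2 * min (a.1 (k + 1)) (a.1 (k + 2)) + residue a.1 (k + 2) ≠ 0 ∧ W k = v :=
    fun a v h => exists_of_sum_ite_ne_zero h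
  obtain ⟨H₁, -⟩ := exists_straightLine (boundaryMap p hp) g fun a => by
    obtain ⟨i, j, hji, hi, hj, hk, hk'⟩ := exists_residue a
    refine ⟨_, hpW i, fun v hv => ?_⟩
    rcases hv with hv | hv
    · obtain ⟨k, h, rfl⟩ := exists_of_wt_boundaryMap_ne_zero hv
      rcases eq_add_one_or_eq_add_two (i := i) (k := k) (by rintro rfl; exact h hi)
        with rfl | rfl <;> simp
    · obtain ⟨k | k, h, rfl⟩ := hg a v hv
      · obtain rfl : k = j := not_imp_comm.1 (hk k) h
        rcases eq_add_one_or_eq_add_two hji with rfl | rfl <;> simp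
      · obtain rfl : k = i := not_imp_comm.1 (hk' k) fun h' => h (by simp [h'])
        simp
  obtain ⟨H₂, -⟩ := exists_straightLine g e fun a => by
    obtain ⟨i, j, hji, hi, hj, hk, hk'⟩ := exists_residue a
    have hi' : W i ∈ ({p j, W (j + 1), W (j + 2)} : Finset V) := by
      rcases eq_add_one_or_eq_add_two hji.symm with rfl | rfl <;> simp
    refine ⟨_, hWp j, fun v hv => ?_⟩
    rcases hv with hv | hv
    · obtain ⟨k | k, h, rfl⟩ := hg a v hv
      · obtain rfl : k = j := not_imp_comm.1 (hk k) h
        simp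
      · obtain rfl : k = i := not_imp_comm.1 (hk' k) fun h' => h (by simp [h'])
        exact hi'
    · obtain ⟨k, h, rfl⟩ := he a v hv
      by_cases hki : k = i
      · exact hki ▸ hi'
      · obtain rfl : k + 2 = j := not_imp_comm.1 (hk (k + 2)) fun h' => h (by simp [h', hk' k hki])
        have : k + 2 + 1 = k := (by decide : ∀ k : Fin 3, k + 2 + 1 = k) k
        simp [this]
  obtain ⟨H₃, -⟩ := exists_straightLine e (ContinuousMap.const _ (space.vertex (W 0) h0))
    fun a => ⟨_, hW, fun v hv => by
      rcases hv with hv | hv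
      · obtain ⟨k, -, rfl⟩ := he a v hv
        fin_cases k <;> simp
      · obtain rfl : v = W 0 := space.eq_of_wt_vertex_ne_zero (hv := h0) hv
        simp⟩
  exact ⟨(H₁.trans H₂).trans H₃⟩

/-- Homotopies to a constant map can be given separately on every piece of a discrete family. -/
theorem homotopic_const_of_discrete {ι A X : Type} [TopologicalSpace ι] [DiscreteTopology ι]
    [TopologicalSpace A] [TopologicalSpace X] (f : C(ι × A, X)) (x : X)
    (h : ∀ i, (f.comp ((ContinuousMap.const A i).prodMk (ContinuousMap.id A))).Homotopic
      (ContinuousMap.const A x)) : f.Homotopic (ContinuousMap.const _ x) := by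
  let H := fun i => (h i).some
  have hH : Continuous fun z : ι × (unitInterval × A) => H z.1 z.2 :=
    continuous_prod_of_discrete_left.2 fun i => (H i).continuous
  exact ⟨⟨⟨fun z => H z.2.1 (z.1, z.2.2), hH.comp ((continuous_fst.comp continuous_snd).prodMk
    (continuous_fst.prodMk (continuous_snd.comp continuous_snd)))⟩,
    fun z => (H z.1).apply_zero z.2, fun z => (H z.1).apply_one z.2⟩⟩

end Nullhomotopy

end AbsSC

namespace TriangleBoundary

theorem exists_cone_coord {b : Fin 3 → ℝ} (h0 : ∀ j, 0 ≤ b j) (h1 : ∑ j, b j = 1) :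
    ∃ (a : TriangleBoundary) (s : unitInterval), ∀ j, (1 - (s : ℝ)) / 3 + s * a.1 j = b j := by
  rw [Fin.sum_univ_three] at h1
  obtain ⟨i, hi⟩ := Finite.exists_min b
  have hle : b i ≤ 1 / 3 := by linarith [hi 0, hi 1, hi 2]
  rcases hle.eq_or_lt with heq | hlt
  · obtain ⟨a, -⟩ := exists_eq_mul (x := 1) (y := 0) (by norm_num)
    refine ⟨a, 0, fun j => ?_⟩
    have : b j = 1 / 3 := by
      have h0 := hi 0
      have h1 := hi 1
      have h2 := hi 2
      fin_cases j <;> simp only [Fin.zero_eta, Fin.mk_one, Fin.reduceFinMk] <;> linarith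
    simp [this]
  · have hs : 0 < 1 - 3 * b i := by linarith
    refine ⟨⟨fun j => (b j - b i) / (1 - 3 * b i), ⟨fun j => div_nonneg (sub_nonneg.2 (hi j)) hs.le,
      ?_⟩, i, by simp⟩, ⟨1 - 3 * b i, hs.le, by linarith [h0 i]⟩, fun j => ?_⟩
    · rw [← Finset.sum_div, Fin.sum_univ_three, div_eq_one_iff_eq hs.ne']
      linarith
    · change (1 - (1 - 3 * b i)) / 3 + (1 - 3 * b i) * ((b j - b i) / (1 - 3 * b i)) = b j
      rw [mul_div_cancel₀ _ hs.ne']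
      ring

theorem le_of_cone_coord_eq {a a' : TriangleBoundary} {s s' : unitInterval}
    (h : ∀ j, (1 - (s : ℝ)) / 3 + s * a.1 j = (1 - (s' : ℝ)) / 3 + s' * a'.1 j) : s ≤ s' := by
  obtain ⟨i, hi⟩ := a.2.2
  have := h i
  rw [hi] at this
  have := mul_nonneg s'.2.1 (a'.nonneg i)
  have : (s : ℝ) ≤ s' := by linarith
  exact this

theorem cone_coord_eq {a a' : TriangleBoundary} {s s' : unitInterval}
    (h : ∀ j, (1 - (s : ℝ)) / 3 + s * a.1 j = (1 - (s' : ℝ)) / 3 + s' * a'.1 j) :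
    s = s' ∧ (s = 0 ∨ a = a') := by
  obtain rfl : s = s' := le_antisymm (le_of_cone_coord_eq h) (le_of_cone_coord_eq fun j => (h j).symm)
  refine ⟨rfl, or_iff_not_imp_left.2 fun hs => Subtype.ext (funext fun j => ?_)⟩
  exact mul_left_cancel₀ (fun h0 => hs (Subtype.ext h0)) (add_left_cancel (h j))

end TriangleBoundary

namespace AbsSC

theorem incl_injective {V : Type} {X K : AbsSC V} (h : X.faces ⊆ K.faces) :
    Function.Injective (incl h) := fun x y hxy =>
  space.ext_wt fun v => (congrFun (congrArg space.wt hxy) v : (incl h x).wt v = (incl h y).wt v)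

variable {V ι : Type} [DecidableEq V] [TopologicalSpace ι] [DiscreteTopology ι] {X K : AbsSC V}

/-- The attaching maps of a family of triangles. -/
noncomputable def attachMap (p : ι → Fin 3 → V)
    (hp : ∀ i k, {p i (k + 1), p i (k + 2)} ∈ X.faces) : C(ι × TriangleBoundary, X.space) :=
  ⟨fun q => boundaryMap (p q.1) (hp q.1) q.2,
    continuous_prod_of_discrete_left.2 fun i => (boundaryMap (p i) (hp i)).continuous⟩

/-- The cone parametrization of a triangle. -/
noncomputable def triangleMap (p : Fin 3 → V) (hp : univ.image p ∈ K.faces) :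
    C(TriangleBoundary × unitInterval, K.space) :=
  combMap p (fun z j => (1 - (z.2 : ℝ)) / 3 + z.2 * z.1.1 j)
    (fun z j => add_nonneg (div_nonneg (sub_nonneg.2 z.2.2.2) (by norm_num))
      (mul_nonneg z.2.2.1 (z.1.nonneg j)))
    (fun z => by
      rw [Fin.sum_univ_three]
      linear_combination (z.2 : ℝ) * z.1.sum_eq_one)
    (fun _ => ⟨_, hp, fun k _ => mem_image_of_mem p (mem_univ k)⟩)
    (fun j => by
      have := (TriangleBoundary.continuous_coord j).comp
        (continuous_fst : Continuous fun z : TriangleBoundary × unitInterval => z.1)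
      have h : Continuous fun z : TriangleBoundary × unitInterval => (z.2 : ℝ) :=
        continuous_subtype_val.comp continuous_snd
      exact ((continuous_const.sub h).div_const 3).add (h.mul this))

theorem wt_triangleMap_eq {p : Fin 3 → V} {hp : univ.image p ∈ K.faces}
    (z : TriangleBoundary × unitInterval) (v : V) : (triangleMap p hp z).wt v =
      ∑ k, if p k = v then (1 - (z.2 : ℝ)) / 3 + z.2 * z.1.1 k else 0 := rfl

theorem wt_triangleMap {p : Fin 3 → V} (hinj : Function.Injective p)
    {hp : univ.image p ∈ K.faces} (z : TriangleBoundary × unitInterval) (j : Fin 3) :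
    (triangleMap p hp z).wt (p j) = (1 - (z.2 : ℝ)) / 3 + z.2 * z.1.1 j := by
  simp [wt_triangleMap_eq, hinj.eq_iff]

theorem wt_boundaryMap_eq {p : Fin 3 → V} {hp : ∀ k, {p (k + 1), p (k + 2)} ∈ X.faces}
    (a : TriangleBoundary) (v : V) : (boundaryMap p hp a).wt v =
      ∑ k, if p k = v then a.1 k else 0 := rfl

theorem wt_triangleMap_ne_zero_iff {p : Fin 3 → V} (hinj : Function.Injective p)
    {hp : univ.image p ∈ K.faces} {z : TriangleBoundary × unitInterval} (hz : z.2 ≠ 1) (v : V) :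
    (triangleMap p hp z).wt v ≠ 0 ↔ v ∈ univ.image p := by
  constructor
  · intro h
    rw [wt_triangleMap_eq] at h
    obtain ⟨k, -, rfl⟩ := exists_of_sum_ite_ne_zero h
    exact mem_image_of_mem p (mem_univ k)
  · intro h
    obtain ⟨k, -, rfl⟩ := mem_image.1 h
    rw [wt_triangleMap hinj]
    have h1 : (z.2 : ℝ) < 1 := lt_of_le_of_ne z.2.2.2 fun h => hz (Subtype.ext h)
    have := mul_nonneg z.2.2.1 (z.1.nonneg k)
    exact (add_pos_of_pos_of_nonneg (div_pos (sub_pos.2 h1) (by norm_num)) this).ne'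

/-- All triangles of a family, parametrized as cones. -/
noncomputable def attachCone (p : ι → Fin 3 → V) (hp : ∀ i, univ.image (p i) ∈ K.faces) :
    C((ι × TriangleBoundary) × unitInterval, K.space) :=
  ⟨fun z => triangleMap (p z.1.1) (hp z.1.1) (z.1.2, z.2), by
    have : Continuous fun z : ι × (TriangleBoundary × unitInterval) =>
        triangleMap (p z.1) (hp z.1) z.2 :=
      continuous_prod_of_discrete_left.2 fun i => (triangleMap (p i) (hp i)).continuous
    exact this.comp ((continuous_fst.comp continuous_fst).prodMk
      ((continuous_snd.comp continuous_fst).prodMk continuous_snd))⟩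

theorem attachCone_one (hXK : X.faces ⊆ K.faces) (p : ι → Fin 3 → V)
    (hp : ∀ i k, {p i (k + 1), p i (k + 2)} ∈ X.faces) (hK : ∀ i, univ.image (p i) ∈ K.faces)
    (q : ι × TriangleBoundary) :
    attachCone p hK (q, 1) = incl hXK (attachMap p hp q) := space.ext_wt fun v => by
  change (triangleMap (p q.1) (hK q.1) (q.2, 1)).wt v = (boundaryMap (p q.1) (hp q.1) q.2).wt v
  rw [wt_triangleMap_eq, wt_boundaryMap_eq]
  simp

theorem exists_incl_or_attachCone (hXK : X.faces ⊆ K.faces) (p : ι → Fin 3 → V)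
    (hinj : ∀ i, Function.Injective (p i)) (hK : ∀ i, univ.image (p i) ∈ K.faces)
    (hKX : ∀ s ∈ K.faces, s ∈ X.faces ∨ ∃ i, s = univ.image (p i)) (y : K.space) :
    (∃ x, incl hXK x = y) ∨ ∃ q, attachCone p hK q = y := by
  obtain ⟨s, hs, hv⟩ := y.exists_supp_eq
  rcases hKX s hs with hs | ⟨i, rfl⟩
  · exact Or.inl ⟨space.ofWt y.wt y.wt_nonneg
      ⟨s, hs, fun v => (hv v).1, y.sum_eq_one fun v => (hv v).1⟩, rfl⟩
  · obtain ⟨a, t, hat⟩ := TriangleBoundary.exists_cone_coord (b := fun j => y.wt (p i j))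
      (fun j => y.wt_nonneg _) (by
        rw [← y.sum_eq_one fun v => (hv v).1, Finset.sum_image fun _ _ _ _ h => hinj i h])
    refine Or.inr ⟨((i, a), t), space.ext_wt fun v => ?_⟩
    change (triangleMap (p i) (hK i) (a, t)).wt v = y.wt v
    by_cases hvi : v ∈ univ.image (p i)
    · obtain ⟨j, -, rfl⟩ := mem_image.1 hvi
      rw [wt_triangleMap (hinj i)]
      exact hat j
    · rw [not_imp_comm.1 (hv v).1 hvi, wt_triangleMap_eq]
      refine Finset.sum_eq_zero fun j _ => if_neg ?_
      rintro rfl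
      exact hvi (mem_image_of_mem _ (mem_univ j))

/-- A complex obtained by adding triangles to a subcomplex is a mapping cone. -/
theorem isMappingCone_attach [Finite ι] (hfin : X.faces.Finite) (hXK : X.faces ⊆ K.faces)
    (p : ι → Fin 3 → V) (hinj : ∀ i, Function.Injective (p i))
    (hp : ∀ i k, {p i (k + 1), p i (k + 2)} ∈ X.faces) (hK : ∀ i, univ.image (p i) ∈ K.faces)
    (hX : ∀ i, univ.image (p i) ∉ X.faces)
    (hpp : ∀ i i', univ.image (p i) = univ.image (p i') → i = i')
    (hKX : ∀ s ∈ K.faces, s ∈ X.faces ∨ ∃ i, s = univ.image (p i)) :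
    IsMappingCone (attachMap p hp) (incl hXK) (attachCone p hK) where
  base := attachCone_one hXK p hp hK
  apex i a a' := space.ext_wt fun v => by
    change (triangleMap (p i) (hK i) (a, 0)).wt v = (triangleMap (p i) (hK i) (a', 0)).wt v
    rw [wt_triangleMap_eq, wt_triangleMap_eq]
    simp
  surj := exists_incl_or_attachCone hXK p hinj hK hKX
  desc P _ u v hb ha := by
    have hone : ∀ x q s, incl hXK x = attachCone p hK (q, s) → s = 1 := fun x q s h => by
      by_contra hs
      obtain ⟨t, ht, htv, -⟩ := x.exists_face
      refine hX q.1 (X.down_closed t ht _ (fun w hw => htv w ?_)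
        (univ_nonempty.image _).ne_empty)
      have : (triangleMap (p q.1) (hK q.1) (q.2, s)).wt w ≠ 0 :=
        (wt_triangleMap_ne_zero_iff (hinj q.1) hs w).2 hw
      rwa [show triangleMap (p q.1) (hK q.1) (q.2, s) = incl hXK x from h.symm] at this
    have hmix : ∀ x z, incl hXK x = attachCone p hK z → u x = v z := by
      rintro x ⟨q, s⟩ h
      obtain rfl := hone x q s h
      rw [hb, incl_injective hXK (h.trans (attachCone_one hXK p hp hK q))]
    have := compactSpace_space hfin
    let π : C(X.space ⊕ (ι × TriangleBoundary) × unitInterval, K.space) :=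
      ⟨Sum.elim (incl hXK) (attachCone p hK),
        (incl hXK).continuous.sumElim (attachCone p hK).continuous⟩
    have hπ : Topology.IsQuotientMap π := by
      refine (π.continuous.isClosedMap).isQuotientMap π.continuous fun y => ?_
      rcases exists_incl_or_attachCone hXK p hinj hK hKX y with ⟨x, rfl⟩ | ⟨z, rfl⟩
      exacts [⟨Sum.inl x, rfl⟩, ⟨Sum.inr z, rfl⟩]
    let w : C(X.space ⊕ (ι × TriangleBoundary) × unitInterval, P) :=
      ⟨Sum.elim u v, u.continuous.sumElim v.continuous⟩
    have hw : Function.FactorsThrough w π := by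
      rintro (x | z) (x' | z') h
      · exact congrArg u (incl_injective hXK h)
      · exact hmix x z' h
      · exact (hmix x' z h.symm).symm
      · obtain ⟨⟨i, a⟩, s⟩ := z
        obtain ⟨⟨i', a'⟩, s'⟩ := z'
        change triangleMap (p i) (hK i) (a, s) = triangleMap (p i') (hK i') (a', s') at h
        change v _ = v _
        by_cases hs : s = 1
        · subst hs
          rw [hb]
          exact hmix (attachMap p hp (i, a)) ((i', a'), s')
            ((attachCone_one hXK p hp hK (i, a)).symm.trans h)
        by_cases hs' : s' = 1
        · subst hs'
          rw [hb]
          exact (hmix (attachMap p hp (i', a')) ((i, a), s)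
            ((attachCone_one hXK p hp hK (i', a')).symm.trans h.symm)).symm
        obtain rfl : i = i' := hpp i i' (by
          ext x
          rw [← wt_triangleMap_ne_zero_iff (hinj i) (hp := hK i) (z := (a, s)) hs, h,
            wt_triangleMap_ne_zero_iff (hinj i') hs'])
        obtain ⟨rfl, rfl | rfl⟩ := TriangleBoundary.cone_coord_eq (a := a) (a' := a') (s := s)
          (s' := s') fun j => by
            rw [← wt_triangleMap (hinj i) (hp := hK i) (a, s), h, wt_triangleMap (hinj i)]
        · exact ha i a a'
        · rfl
    exact ⟨hπ.lift w hw, fun x => DFunLike.congr_fun (hπ.lift_comp w hw) (Sum.inl x),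
      fun z => DFunLike.congr_fun (hπ.lift_comp w hw) (Sum.inr z)⟩

end AbsSC

namespace AbsSC

section Avoid

variable {V : Type}

/-- The faces of `K` that contain no member of `bad`. -/
def avoid (K : AbsSC V) (bad : Set (Finset V)) : AbsSC V where
  faces := {σ | σ ∈ K.faces ∧ ∀ τ ∈ bad, ¬τ ⊆ σ}
  not_empty_mem h := K.not_empty_mem h.1
  down_closed s hs t hts ht :=
    ⟨K.down_closed s hs.1 t hts ht, fun τ hτ h => hs.2 τ hτ (h.trans hts)⟩

theorem avoid_subset (K : AbsSC V) (bad : Set (Finset V)) : (K.avoid bad).faces ⊆ K.faces :=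
  fun _ h => h.1

variable [DecidableEq V] {K : AbsSC V}

theorem vertex_homotopic_const (P : Type) [TopologicalSpace P] {v : V} (hv : {v} ∈ K.faces)
    {x : K.space} (hx : ∀ w, x.wt w ≠ 0 → w = v) :
    (ContinuousMap.const P (space.vertex v hv)).Homotopic (ContinuousMap.const P x) := by
  obtain ⟨H, -⟩ := exists_straightLine (ContinuousMap.const P (space.vertex v hv))
    (ContinuousMap.const P x) fun _ => ⟨{v}, hv, fun u hu => mem_singleton.2 <| hu.elim
      (space.eq_of_wt_vertex_ne_zero (hv := hv)) (hx u)⟩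
  exact ⟨H⟩

end Avoid

section Transport

variable {V W : Type} [DecidableEq W] {K : AbsSC V} {L : AbsSC W}

/-- The map of realizations induced by a simplicial map `φ` with a left inverse `ψ` on
vertices. -/
noncomputable def transport (φ : V → W) (ψ : W → V) (hφ : ∀ s ∈ K.faces, s.image φ ∈ L.faces)
    (hψ : ∀ s ∈ K.faces, ∀ v ∈ s, ψ (φ v) = v) : C(K.space, L.space) where
  toFun x := space.ofWt (fun w => if φ (ψ w) = w then x.wt (ψ w) else 0)
    (fun w => by split_ifs; exacts [x.wt_nonneg _, le_rfl]) (by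
      obtain ⟨s, hs, hx, hsum⟩ := x.exists_face
      refine ⟨_, hφ s hs, fun w hw => ?_, ?_⟩
      · rw [ite_ne_right_iff] at hw
        exact mem_image.2 ⟨_, hx _ hw.2, hw.1⟩
      · rw [sum_image fun v hv v' hv' h => by rw [← hψ s hs v hv, ← hψ s hs v' hv', h], ← hsum]
        exact sum_congr rfl fun v hv => by rw [hψ s hs v hv, if_pos rfl])
  continuous_toFun := space.continuous_mk fun w => by
    simp only [space.wt_ofWt]
    split_ifs
    exacts [space.continuous_wt_apply _, continuous_const]

theorem wt_transport {φ : V → W} {ψ : W → V} {hφ : ∀ s ∈ K.faces, s.image φ ∈ L.faces}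
    {hψ : ∀ s ∈ K.faces, ∀ v ∈ s, ψ (φ v) = v} (x : K.space) (w : W) :
    (transport φ ψ hφ hψ x).wt w = if φ (ψ w) = w then x.wt (ψ w) else 0 := rfl

theorem transport_transport [DecidableEq V] {φ : V → W} {ψ : W → V} {hφ : ∀ s ∈ K.faces, s.image φ ∈ L.faces}
    {hψ : ∀ s ∈ K.faces, ∀ v ∈ s, ψ (φ v) = v} (hφ' : ∀ s ∈ L.faces, s.image ψ ∈ K.faces)
    (hψ' : ∀ s ∈ L.faces, ∀ w ∈ s, φ (ψ w) = w) (x : K.space) :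
    transport ψ φ hφ' hψ' (transport φ ψ hφ hψ x) = x := space.ext_wt fun v => by
  obtain ⟨s, hs, hx, -⟩ := x.exists_face
  rw [wt_transport, wt_transport]
  by_cases hv : x.wt v = 0
  · split_ifs with h
    · rw [h]
    · exact hv.symm
    · exact hv.symm
  · rw [hψ s hs v (hx v hv), if_pos rfl, if_pos rfl]

theorem isStrongDeformationRetract_transport [DecidableEq V] {φ : V → W} {ψ : W → V}
    {hφ : ∀ s ∈ K.faces, s.image φ ∈ L.faces} {hψ : ∀ s ∈ K.faces, ∀ v ∈ s, ψ (φ v) = v}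
    (hφ' : ∀ s ∈ L.faces, s.image ψ ∈ K.faces) (hψ' : ∀ s ∈ L.faces, ∀ w ∈ s, φ (ψ w) = w) :
    IsStrongDeformationRetract (transport φ ψ hφ hψ) := by
  refine ⟨transport ψ φ hφ' hψ', ContinuousMap.ext fun x => transport_transport hφ' hψ' x, ?_⟩
  have h : (transport φ ψ hφ hψ).comp (transport ψ φ hφ' hψ') = ContinuousMap.id L.space :=
    ContinuousMap.ext fun x => transport_transport hφ hψ x
  rw [h]
  exact ⟨ContinuousMap.Homotopy.refl _, fun _ _ => rfl⟩

end Transport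

end AbsSC

namespace Johnson

open AbsSC

variable {m n : ℕ} {A B C S : Finset ℕ} {σ τ : Finset (Finset ℕ)}

theorem card_symmDiff_add (A B : Finset ℕ) : #(symmDiff A B) + 2 * #(A ∩ B) = #A + #B := by
  have h : #(symmDiff A B) = #(A \ B) + #(B \ A) := card_union_of_disjoint disjoint_sdiff_sdiff
  have hA := card_sdiff_add_card_inter A B
  have hB := card_sdiff_add_card_inter B A
  rw [inter_comm] at hB
  omega

/-- The cliques of the Johnson graph. -/
abbrev cliques (m n : ℕ) : AbsSC (Finset ℕ) := VRc (Fnm m n) 2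

theorem mem_cliques : σ ∈ (cliques m n).faces ↔ σ.Nonempty ∧
    (∀ A ∈ σ, A ⊆ Icc 1 m ∧ #A = n) ∧ ∀ A ∈ σ, ∀ B ∈ σ, n ≤ #(A ∩ B) + 1 := by
  refine and_congr_right fun _ => and_congr_right fun h => forall₄_congr fun A hA B hB => ?_
  have := card_symmDiff_add A B
  have hA : #A = n := (h A hA).2
  have hB : #B = n := (h B hB).2
  omega

theorem finite_cliques (m n : ℕ) : (cliques m n).faces.Finite :=
  (finite_toSet (Icc 1 m).powerset.powerset).subset fun _ hσ =>
    mem_coe.2 (mem_powerset.2 fun A hA => mem_powerset.2 ((mem_cliques.1 hσ).2.1 A hA).1)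

theorem mem_cliques_of_subset (hS : S ⊆ Icc 1 m) (hcard : #S ≤ n + 1) (hσ : σ.Nonempty)
    (h : ∀ A ∈ σ, A ⊆ S ∧ #A = n) : σ ∈ (cliques m n).faces := by
  refine mem_cliques.2 ⟨hσ, fun A hA => ⟨(h A hA).1.trans hS, (h A hA).2⟩, fun A hA B hB => ?_⟩
  have := card_union_add_card_inter A B
  have := card_le_card (union_subset (h A hA).1 (h B hB).1)
  have := (h A hA).2
  have := (h B hB).2
  omega

theorem mem_cliques_of_superset (hC : n ≤ #C + 1) (hσ : σ.Nonempty)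
    (h : ∀ A ∈ σ, C ⊆ A ∧ A ⊆ Icc 1 m ∧ #A = n) : σ ∈ (cliques m n).faces :=
  mem_cliques.2 ⟨hσ, fun A hA => (h A hA).2, fun A hA B hB =>
    hC.trans (Nat.succ_le_succ (card_le_card (subset_inter (h A hA).1 (h B hB).1)))⟩

theorem erase_subset_of_adj {y : ℕ} (hA : #A = n) (h : n ≤ #(A ∩ B) + 1) (hyA : y ∈ A)
    (hyB : y ∉ B) : A.erase y ⊆ B := by
  have hsub : A ∩ B ⊆ A.erase y := fun x hx =>
    mem_erase.2 ⟨fun hxy => hyB (hxy ▸ (mem_inter.1 hx).2), (mem_inter.1 hx).1⟩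
  rw [← eq_of_subset_of_card_le hsub (by rw [card_erase_of_mem hyA]; omega)]
  exact inter_subset_right

theorem subset_sup (hA : A ∈ τ) : A ⊆ τ.sup id := le_sup (f := id) hA

theorem subset_sup_of_triple (hσ : σ ∈ (cliques m n).faces) (hτσ : τ ⊆ σ) (hτ : #τ = 3)
    (hS : #(τ.sup id) = n + 1) (hA : A ∈ σ) : A ⊆ τ.sup id := by
  obtain ⟨-, hcard, hadj⟩ := mem_cliques.1 hσ
  by_contra hAS
  obtain ⟨y, hyA, hyS⟩ := not_subset.1 hAS
  have hC : ∀ B ∈ τ, A.erase y ⊆ B := fun B hB =>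
    erase_subset_of_adj (hcard A hA).2 (hadj A hA B (hτσ hB)) hyA fun h => hyS (subset_sup hB h)
  have hn : #(A.erase y) + 1 = n := by rw [card_erase_add_one hyA, (hcard A hA).2]
  obtain ⟨B₀, hB₀⟩ : τ.Nonempty := card_pos.1 (by omega)
  have h := card_le_card_of_injOn (s := τ) (t := powersetCard 1 (τ.sup id \ A.erase y))
    (fun B => B \ A.erase y) (fun B hB => mem_coe.2 (mem_powersetCard.2
      ⟨sdiff_subset_sdiff (subset_sup hB) Subset.rfl, by
        rw [card_sdiff_of_subset (hC B hB), (hcard B (hτσ hB)).2]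
        omega⟩)) fun B hB B' hB' h => by
      rw [← sdiff_union_of_subset (hC B hB), ← sdiff_union_of_subset (hC B' hB')]
      exact congrArg (· ∪ A.erase y) h
  rw [card_powersetCard, Nat.choose_one_right, hτ,
    card_sdiff_of_subset ((hC B₀ hB₀).trans (subset_sup hB₀))] at h
  omega

/-- Triples of vertices in the closed simplex of all `n`-subsets of an `(n+1)`-set without `m`. -/
def triples (m n : ℕ) : Set (Finset (Finset ℕ)) :=
  {τ | #τ = 3 ∧ #(τ.sup id) = n + 1 ∧ m ∉ τ.sup id}

/-- The set `S` without its greatest element. -/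
def eraseTop (S : Finset ℕ) : Finset ℕ := S.erase (S.sup id)

theorem sup_mem (hS : S.Nonempty) : S.sup id ∈ S := by
  obtain ⟨x, hx, h⟩ := exists_mem_eq_sup S hS id
  exact h ▸ hx

/-- The triples that do not contain the first vertex of their closed simplex. -/
def farTriples (m n : ℕ) : Set (Finset (Finset ℕ)) :=
  {τ | τ ∈ triples m n ∧ eraseTop (τ.sup id) ∉ τ}

theorem sup_subset_Icc (hσ : σ ∈ (cliques m n).faces) (hτσ : τ ⊆ σ) : τ.sup id ⊆ Icc 1 m :=
  Finset.sup_le fun A hA => ((mem_cliques.1 hσ).2.1 A (hτσ hA)).1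

theorem isStrongDeformationRetract_avoid_farTriples (m n : ℕ) :
    IsStrongDeformationRetract (incl (avoid_subset (cliques m n) (farTriples m n))) := by
  refine isStrongDeformationRetract_incl (w := fun τ => eraseTop (τ.sup id)) (finite_cliques m n)
    (bad := farTriples m n) (fun τ hτ h => ?_) (fun σ hσ τ hτ hτσ => ?_) _ fun _ => Iff.rfl
  · have := hτ.1.1
    simp [h] at this
  · obtain ⟨⟨h3, hS, -⟩, -⟩ := hτ
    have hw : eraseTop (τ.sup id) ⊆ τ.sup id ∧ #(eraseTop (τ.sup id)) = n :=
      ⟨erase_subset _ _, by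
        rw [eraseTop, card_erase_of_mem (sup_mem (card_pos.1 (by omega))), hS, Nat.add_sub_cancel]⟩
    have hsub : ∀ A ∈ insert (eraseTop (τ.sup id)) σ, A ⊆ τ.sup id ∧ #A = n :=
      forall_mem_insert _ _ _ |>.2 ⟨hw, fun A hA =>
        ⟨subset_sup_of_triple hσ hτσ h3 hS hA, ((mem_cliques.1 hσ).2.1 A hA).2⟩⟩
    refine ⟨mem_cliques_of_subset (sup_subset_Icc hσ hτσ) hS.le (insert_nonempty _ _) hsub,
      fun τ' hτ' hsub' => ?_⟩
    have : τ'.sup id = τ.sup id := eq_of_subset_of_card_le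
      (Finset.sup_le fun A hA => (hsub A (hsub' hA)).1) (by rw [hS, hτ'.1.2.1])
    exact ⟨congrArg eraseTop this, this ▸ hτ'.2⟩

/-- The cliques without triples. -/
def thin (m n : ℕ) : AbsSC (Finset ℕ) := (cliques m n).avoid (triples m n)

theorem mem_thin (hσ : σ ∈ (cliques m n).faces) (h : #(σ.filter (m ∉ ·)) ≤ 2) :
    σ ∈ (thin m n).faces := by
  refine ⟨hσ, fun τ hτ hτσ => ?_⟩
  have : τ ⊆ σ.filter (m ∉ ·) := fun A hA =>
    mem_filter.2 ⟨hτσ hA, fun hm => hτ.2.2 (subset_sup hA hm)⟩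
  have := card_le_card this
  have := hτ.1
  omega

theorem finite_thin (m n : ℕ) : (thin m n).faces.Finite :=
  (finite_cliques m n).subset (avoid_subset _ _)

/-- The pairs of vertices without `m`. -/
def pairs (m : ℕ) : Set (Finset (Finset ℕ)) := {τ | #τ = 2 ∧ ∀ A ∈ τ, m ∉ A}

/-- The intersection of all members of `τ`. -/
def common (τ : Finset (Finset ℕ)) : Finset ℕ := (τ.sup id).filter fun x => ∀ A ∈ τ, x ∈ A

theorem subset_common (hτ : τ.Nonempty) (h : ∀ A ∈ τ, C ⊆ A) : C ⊆ common τ := fun x hx => by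
  obtain ⟨A, hA⟩ := hτ
  exact mem_filter.2 ⟨subset_sup hA (h A hA hx), fun B hB => h B hB hx⟩

theorem common_subset (hA : A ∈ τ) : common τ ⊆ A := fun _ hx => (mem_filter.1 hx).2 A hA

theorem card_common_lt (hτ : #τ = 2) (h : ∀ A ∈ τ, #A = n) : #(common τ) < n := by
  obtain ⟨A, B, hAB, rfl⟩ := card_eq_two.1 hτ
  have hA := h A (by simp)
  have hB := h B (by simp)
  by_contra! hle
  refine hAB ?_
  rw [← eq_of_subset_of_card_le (common_subset (mem_insert_self A {B})) (by omega)]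
  exact eq_of_subset_of_card_le (common_subset (by simp)) (by omega)

theorem common_subset_of_mem (hσ : σ ∈ (thin m n).faces) (hτ : τ ∈ pairs m) (hτσ : τ ⊆ σ)
    (hA : A ∈ σ) : common τ ⊆ A := by
  obtain ⟨hσ, hthin⟩ := hσ
  obtain ⟨-, hcard, hadj⟩ := mem_cliques.1 hσ
  by_cases hAτ : A ∈ τ
  · exact common_subset hAτ
  have hlt := card_common_lt hτ.1 fun B hB => (hcard B (hτσ hB)).2
  obtain ⟨B, B', hBB', rfl⟩ := card_eq_two.1 hτ.1
  obtain ⟨hB, hB'⟩ := insert_subset_iff.1 hτσ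
  rw [singleton_subset_iff] at hB'
  have hu := card_union_add_card_inter B B'
  have := hadj B hB B' hB'
  have hcB := (hcard B hB).2
  have hcB' := (hcard B' hB').2
  have hsub : B ∩ B' ⊆ common {B, B'} := fun x hx => by
    obtain ⟨h1, h2⟩ := mem_inter.1 hx
    exact mem_filter.2 ⟨subset_sup (mem_insert_self B {B'}) h1, by simp [h1, h2]⟩
  have := card_le_card hsub
  by_cases hAS : A ⊆ B ∪ B'
  · refine absurd ?_ (hthin (insert A {B, B'}) ⟨?_, ?_⟩)
    · exact insert_subset hA hτσ
    · rw [card_insert_of_notMem hAτ, hτ.1]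
    · have : (insert A {B, B'} : Finset (Finset ℕ)).sup id = B ∪ B' := by
        simp only [sup_insert, sup_singleton, id]
        exact sup_eq_right.2 hAS
      rw [this]
      refine ⟨by omega, fun hm => ?_⟩
      have := hτ.2 B (by simp)
      have := hτ.2 B' (by simp)
      simp_all
  · obtain ⟨y, hyA, hy⟩ := not_subset.1 hAS
    rw [mem_union, not_or] at hy
    have h1 := erase_subset_of_adj (hcard A hA).2 (hadj A hA B hB) hyA hy.1
    have h2 := erase_subset_of_adj (hcard A hA).2 (hadj A hA B' hB') hyA hy.2
    have h3 : A.erase y ⊆ common {B, B'} := (subset_inter h1 h2).trans hsub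
    rw [← eq_of_subset_of_card_le h3 (by
      rw [card_erase_of_mem hyA, (hcard A hA).2]; omega)]
    exact erase_subset _ _

theorem isStrongDeformationRetract_avoid_pairs (hm : 1 ≤ m) (n : ℕ) :
    IsStrongDeformationRetract (incl (avoid_subset (thin m n) (pairs m))) := by
  refine isStrongDeformationRetract_incl (w := fun τ => insert m (common τ)) (finite_thin m n)
    (bad := pairs m) (fun τ hτ h => ?_) (fun σ hσ τ hτ hτσ => ?_) _ fun _ => Iff.rfl
  · have := hτ.1
    simp [h] at this
  · obtain ⟨-, hcard, hadj⟩ := mem_cliques.1 hσ.1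
    have hle : ∀ τ' ∈ pairs m, τ' ⊆ σ → #(common τ') + 1 = n := fun τ' hτ' hsub' => by
      have hlt := card_common_lt hτ'.1 fun B hB => (hcard B (hsub' hB)).2
      obtain ⟨B, B', -, rfl⟩ := card_eq_two.1 hτ'.1
      have := hadj B (hsub' (by simp)) B' (hsub' (by simp))
      have hsub : B ∩ B' ⊆ common {B, B'} := subset_common (by simp) (by simp)
      have := card_le_card hsub
      omega
    have hmc : ∀ τ' ∈ pairs m, m ∉ common τ' := fun τ' hτ' h => by
      obtain ⟨B, hB⟩ : τ'.Nonempty := card_pos.1 (by rw [hτ'.1]; norm_num)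
      exact hτ'.2 B hB (common_subset hB h)
    have hIcc : common τ ⊆ Icc 1 m := (filter_subset _ _).trans (sup_subset_Icc hσ.1 hτσ)
    have hmem : insert (insert m (common τ)) σ ∈ (cliques m n).faces :=
      mem_cliques_of_superset (hle τ hτ hτσ).ge (insert_nonempty _ _) <|
        forall_mem_insert _ _ _ |>.2 ⟨⟨subset_insert _ _,
          insert_subset (mem_Icc.2 ⟨hm, le_rfl⟩) hIcc, by
            rw [card_insert_of_notMem (hmc τ hτ), hle τ hτ hτσ]⟩,
          fun A hA => ⟨common_subset_of_mem hσ hτ hτσ hA, hcard A hA⟩⟩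
    refine ⟨⟨hmem, fun τ' hτ' hsub' => hσ.2 τ' hτ' ?_⟩, fun τ' hτ' hsub' => ?_⟩
    · rwa [subset_insert_iff_of_notMem fun h =>
        hτ'.2.2 (subset_sup h (mem_insert_self _ _))] at hsub'
    · have hw : insert m (common τ) ∉ τ' := fun h => hτ'.2 _ h (mem_insert_self _ _)
      rw [subset_insert_iff_of_notMem hw] at hsub'
      have : common τ ⊆ common τ' := subset_common (card_pos.1 (by rw [hτ'.1]; norm_num))
        fun A hA => common_subset_of_mem hσ hτ hτσ (hsub' hA)
      have := eq_of_subset_of_card_le this (by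
        have := hle τ hτ hτσ
        have := hle τ' hτ' hsub'
        omega)
      exact ⟨congrArg (insert m) this.symm, hw⟩

/-- The vertices without `m`, as singletons. -/
def singles (m : ℕ) : Set (Finset (Finset ℕ)) := {τ | ∃ A, m ∉ A ∧ τ = {A}}

theorem isStrongDeformationRetract_avoid_singles (hm : 1 ≤ m) (hn : 1 ≤ n) :
    IsStrongDeformationRetract (incl (avoid_subset ((thin m n).avoid (pairs m)) (singles m))) := by
  refine isStrongDeformationRetract_incl (w := fun τ => insert m (eraseTop (τ.sup id)))
    ((finite_thin m n).subset (avoid_subset _ _))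
    (bad := singles m) (fun τ hτ h => ?_) (fun σ hσ τ hτ hτσ => ?_) _ fun _ => Iff.rfl
  · obtain ⟨A, -, rfl⟩ := hτ
    exact singleton_ne_empty A h
  · obtain ⟨B, hmB, rfl⟩ := hτ
    obtain ⟨⟨hσ, -⟩, hpairs⟩ := hσ
    obtain ⟨-, hcard, hadj⟩ := mem_cliques.1 hσ
    simp only [singleton_subset_iff] at hτσ
    rw [sup_singleton, id]
    have hm' : ∀ A ∈ σ, m ∉ A → A = B := fun A hA hmA => by
      by_contra hAB
      exact hpairs {A, B} ⟨card_pair hAB, by simp [hmA, hmB]⟩ (insert_subset hA (by simpa))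
    have hw : insert m (eraseTop B) ⊆ insert m B ∧ #(insert m (eraseTop B)) = n := by
      refine ⟨insert_subset_insert _ (erase_subset _ _), ?_⟩
      have := (hcard B hτσ).2
      rw [eraseTop, card_insert_of_notMem fun h => hmB (erase_subset _ _ h),
        card_erase_add_one (sup_mem (card_pos.1 (by omega))), this]
    have hsub : ∀ A ∈ insert (insert m (eraseTop B)) σ, A ⊆ insert m B ∧ #A = n :=
      forall_mem_insert _ _ _ |>.2 ⟨hw, fun A hA => ⟨by
        by_cases hmA : m ∈ A
        · exact subset_insert_iff.2
            (erase_subset_of_adj (hcard A hA).2 (hadj A hA B hτσ) hmA hmB)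
        · exact hm' A hA hmA ▸ subset_insert _ _, (hcard A hA).2⟩⟩
    have hm'' : ∀ A ∈ insert (insert m (eraseTop B)) σ, m ∉ A → A = B := fun A hA hmA =>
      hm' A (mem_of_mem_insert_of_ne hA fun h => hmA (h ▸ mem_insert_self _ _)) hmA
    have hmem : insert (insert m (eraseTop B)) σ ∈ (cliques m n).faces :=
      mem_cliques_of_subset (insert_subset (mem_Icc.2 ⟨hm, le_rfl⟩) (hcard B hτσ).1)
        (by rw [card_insert_of_notMem hmB, (hcard B hτσ).2]) (insert_nonempty _ _) hsub
    refine ⟨⟨mem_thin hmem ?_, fun τ' hτ' hsub' => ?_⟩, ?_⟩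
    · refine (card_le_card (t := {B}) fun A hA => ?_).trans (by simp)
      exact mem_singleton.2 (hm'' A (mem_filter.1 hA).1 (mem_filter.1 hA).2)
    · have := card_le_card (s := τ') (t := {B}) fun A hA =>
        mem_singleton.2 (hm'' A (hsub' hA) (hτ'.2 A hA))
      rw [hτ'.1, card_singleton] at this
      omega
    · rintro _ ⟨B', hmB', rfl⟩ hsub'
      obtain rfl := hm'' B' (singleton_subset_iff.1 hsub') hmB'
      exact ⟨by rw [sup_singleton, id], fun h => hmB' (mem_singleton.1 h ▸ mem_insert_self _ _)⟩

end Johnson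

namespace Johnson

open AbsSC

variable {m n : ℕ} {A B S : Finset ℕ} {σ τ : Finset (Finset ℕ)} {c : Fin 3 → ℕ}

theorem singleton_mem_thin (hA : A ⊆ Icc 1 m ∧ #A = n) : {A} ∈ (thin m n).faces :=
  mem_thin (mem_cliques_of_superset (C := A) (by omega) (singleton_nonempty A)
    (by simpa using hA)) ((card_filter_le _ _).trans (by simp))

theorem const_homotopic_const (P : Type) [TopologicalSpace P] (hA : {A} ∈ (thin m n).faces)
    (hB : {B} ∈ (thin m n).faces) : (ContinuousMap.const P (space.vertex A hA)).Homotopic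
      (ContinuousMap.const P (space.vertex B hB)) := by
  obtain ⟨hBm, hBn⟩ := (mem_cliques.1 hB.1).2.1 B (mem_singleton_self B)
  induction h : #(B \ A) generalizing A with
  | zero =>
    obtain ⟨hAm, hAn⟩ := (mem_cliques.1 hA.1).2.1 A (mem_singleton_self A)
    obtain rfl := eq_of_subset_of_card_le (sdiff_eq_empty_iff_subset.1 (card_eq_zero.1 h))
      (by rw [hAn, hBn])
    exact .refl _
  | succ k ih =>
    obtain ⟨hAm, hAn⟩ := (mem_cliques.1 hA.1).2.1 A (mem_singleton_self A)
    obtain ⟨b, hb⟩ : (B \ A).Nonempty := card_pos.1 (by omega)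
    obtain ⟨hbB, hbA⟩ := mem_sdiff.1 hb
    have hle : ¬A ⊆ B := fun hAB =>
      hbA (eq_of_subset_of_card_le hAB (by rw [hAn, hBn]) ▸ hbB)
    obtain ⟨a, haA, haB⟩ := not_subset.1 hle
    have hA' : insert b (A.erase a) ⊆ Icc 1 m ∧ #(insert b (A.erase a)) = n :=
      ⟨insert_subset (hBm hbB) ((erase_subset _ _).trans hAm), by
        rw [card_insert_of_notMem fun h => hbA (erase_subset _ _ h), card_erase_add_one haA, hAn]⟩
    have hedge : {A, insert b (A.erase a)} ∈ (thin m n).faces :=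
      mem_thin (mem_cliques_of_superset (C := A.erase a) (by rw [card_erase_add_one haA, hAn])
        (insert_nonempty _ _) (by simp [erase_subset, hAm, hAn, hA']))
        ((card_filter_le _ _).trans card_le_two)
    refine (const_vertex_homotopic P hA (singleton_mem_thin hA') hedge).trans (ih _ ?_)
    have : B \ insert b (A.erase a) = (B \ A).erase b := by
      ext x
      simp only [mem_sdiff, mem_insert, mem_erase]
      have : x ∈ B → x ≠ a := fun h h' => haB (h' ▸ h)
      tauto
    rw [this, card_erase_of_mem hb, h, Nat.add_sub_cancel]

/-- Three elements of an `(n+1)`-subset of `[m-1]`. -/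
structure IsTripod (m n : ℕ) (S : Finset ℕ) (c : Fin 3 → ℕ) : Prop where
  subset : S ⊆ Icc 1 (m - 1)
  card : #S = n + 1
  injective : Function.Injective c
  mem : ∀ k, c k ∈ S

namespace IsTripod

theorem subset_Icc (h : IsTripod m n S c) : S ⊆ Icc 1 m :=
  h.subset.trans (Icc_subset_Icc_right (Nat.sub_le m 1))

theorem notMem (h : IsTripod m n S c) (hm : 1 ≤ m) : m ∉ S := fun hS => by
  have := mem_Icc.1 (h.subset hS)
  omega

theorem card_erase (h : IsTripod m n S c) (k : Fin 3) : #(S.erase (c k)) = n := by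
  rw [card_erase_of_mem (h.mem k), h.card, Nat.add_sub_cancel]

theorem erase_injective (h : IsTripod m n S c) :
    Function.Injective fun k => S.erase (c k) := fun i j hij =>
  h.injective (erase_injOn S (h.mem i) (h.mem j) hij)

theorem card_image (h : IsTripod m n S c) : #(univ.image fun k => S.erase (c k)) = 3 := by
  rw [card_image_of_injective _ h.erase_injective, card_univ, Fintype.card_fin]

theorem sup_image (h : IsTripod m n S c) : (univ.image fun k => S.erase (c k)).sup id = S := by
  refine subset_antisymm (Finset.sup_le fun A hA => ?_) fun x hx => ?_
  · obtain ⟨k, -, rfl⟩ := mem_image.1 hA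
    exact erase_subset _ _
  · obtain ⟨k, hk⟩ : ∃ k, x ≠ c k := by
      by_contra! hall
      exact absurd (h.injective ((hall 0).symm.trans (hall 1))) (by decide)
    exact subset_sup (mem_image_of_mem _ (mem_univ k)) (mem_erase.2 ⟨hk, hx⟩)

theorem image_mem_triples (h : IsTripod m n S c) (hm : 1 ≤ m) :
    (univ.image fun k => S.erase (c k)) ∈ triples m n :=
  ⟨h.card_image, by rw [h.sup_image, h.card], by rw [h.sup_image]; exact h.notMem hm⟩

theorem image_mem_cliques (h : IsTripod m n S c) :
    (univ.image fun k => S.erase (c k)) ∈ (cliques m n).faces :=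
  mem_cliques_of_subset h.subset_Icc h.card.le (univ_nonempty.image _) fun A hA => by
    obtain ⟨k, -, rfl⟩ := mem_image.1 hA
    exact ⟨erase_subset _ _, h.card_erase k⟩

theorem pair_mem_thin (h : IsTripod m n S c) (i j : Fin 3) :
    {S.erase (c i), S.erase (c j)} ∈ (thin m n).faces :=
  mem_thin (mem_cliques_of_subset h.subset_Icc h.card.le (insert_nonempty _ _)
    (by simp [erase_subset, h.card_erase])) ((card_filter_le _ _).trans card_le_two)

theorem mem_avoid_farTriples (h : IsTripod m n S c) (h0 : c 0 = S.sup id) :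
    (univ.image fun k => S.erase (c k)) ∈ ((cliques m n).avoid (farTriples m n)).faces := by
  refine ⟨h.image_mem_cliques, fun τ hτ hsub => hτ.2 ?_⟩
  obtain rfl := eq_of_subset_of_card_le hsub (by rw [h.card_image, hτ.1.1])
  rw [h.sup_image, eraseTop, ← h0]
  exact mem_image_of_mem (fun k => S.erase (c k)) (mem_univ 0)

theorem card_sdiff_pair (h : IsTripod m n S c) (k : Fin 3) :
    #(S \ {c (k + 1), c (k + 2)}) + 1 = n := by
  have hne : c (k + 1) ≠ c (k + 2) :=
    h.injective.ne ((by decide : ∀ k : Fin 3, k + 1 ≠ k + 2) k)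
  have hsub : {c (k + 1), c (k + 2)} ⊆ S := by simp [insert_subset_iff, h.mem]
  have hle := card_le_card (hsub)
  rw [card_pair hne, h.card] at hle
  have h3 := card_le_card (s := univ.image c) (t := S) fun x hx => by
    obtain ⟨k, -, rfl⟩ := mem_image.1 hx
    exact h.mem k
  rw [card_image_of_injective _ h.injective, card_univ, Fintype.card_fin, h.card] at h3
  rw [card_sdiff_of_subset hsub, card_pair hne, h.card]
  omega

theorem card_wing (h : IsTripod m n S c) (hm : 1 ≤ m) (k : Fin 3) :
    #(insert m (S \ {c (k + 1), c (k + 2)})) = n := by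
  rw [card_insert_of_notMem fun hS => h.notMem hm (sdiff_subset hS), h.card_sdiff_pair]

theorem wing_subset_Icc (h : IsTripod m n S c) (hm : 1 ≤ m) (k : Fin 3) :
    insert m (S \ {c (k + 1), c (k + 2)}) ⊆ Icc 1 m :=
  insert_subset (mem_Icc.2 ⟨hm, le_rfl⟩) (sdiff_subset.trans h.subset_Icc)

theorem boundaryMap_homotopic (h : IsTripod m n S c) (hm : 1 ≤ m)
    (hp : ∀ k, {S.erase (c (k + 1)), S.erase (c (k + 2))} ∈ (thin m n).faces)
    (hB : {B} ∈ (thin m n).faces) :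
    (boundaryMap (fun k => S.erase (c k)) hp).Homotopic
      (ContinuousMap.const _ (space.vertex B hB)) := by
  have hface : ∀ k, S.erase (c k) ⊆ Icc 1 m := fun k => (erase_subset _ _).trans h.subset_Icc
  refine (boundaryMap_homotopic_const _ (fun k => insert m (S \ {c (k + 1), c (k + 2)})) hp
    (fun k => mem_thin ?_ ?_) (fun k => mem_thin ?_ ?_) (mem_thin ?_ ?_)
    (singleton_mem_thin ⟨h.wing_subset_Icc hm 0, h.card_wing hm 0⟩)).trans
    (const_homotopic_const _ _ hB)
  · refine mem_cliques_of_superset (C := S \ {c (k + 1), c (k + 2)})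
      (h.card_sdiff_pair k).ge (insert_nonempty _ _) ?_
    have hsub : ∀ x ∈ ({c (k + 1), c (k + 2)} : Finset ℕ),
        S \ {c (k + 1), c (k + 2)} ⊆ S.erase x := fun x hx => by
      rw [erase_eq]
      exact sdiff_subset_sdiff Subset.rfl (singleton_subset_iff.2 hx)
    simp only [mem_insert, mem_singleton, forall_eq_or_imp, forall_eq] at hsub ⊢
    exact ⟨⟨hsub.1, hface _, h.card_erase _⟩, ⟨hsub.2, hface _, h.card_erase _⟩,
      subset_insert _ _, h.wing_subset_Icc hm k, h.card_wing hm k⟩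
  · refine (card_le_card (t := {S.erase (c (k + 1)), S.erase (c (k + 2))}) ?_).trans card_le_two
    intro A hA
    simp only [mem_filter, mem_insert, mem_singleton] at hA ⊢
    obtain ⟨hA | hA | rfl, hmA⟩ := hA
    exacts [.inl hA, .inr hA, absurd (mem_insert_self _ _) hmA]
  · refine mem_cliques_of_subset (S := insert m (S.erase (c k)))
      (insert_subset (mem_Icc.2 ⟨hm, le_rfl⟩) (hface k)) ((card_insert_le _ _).trans
        (by rw [h.card_erase])) (insert_nonempty _ _) ?_
    have hsub : ∀ e : Finset ℕ, c k ∈ e → insert m (S \ e) ⊆ insert m (S.erase (c k)) :=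
      fun e he => by
        rw [erase_eq]
        exact insert_subset_insert _ (sdiff_subset_sdiff Subset.rfl (singleton_subset_iff.2 he))
    have h1 : k + 1 + 2 = k := (by decide : ∀ k : Fin 3, k + 1 + 2 = k) k
    have h2 : k + 2 + 1 = k := (by decide : ∀ k : Fin 3, k + 2 + 1 = k) k
    simp only [mem_insert, mem_singleton, forall_eq_or_imp, forall_eq]
    exact ⟨⟨subset_insert _ _, h.card_erase _⟩, ⟨hsub _ (by simp [h1]), h.card_wing hm _⟩,
      hsub _ (by simp [h2]), h.card_wing hm _⟩
  · refine (card_le_card (t := {S.erase (c k)}) ?_).trans (by simp)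
    intro A hA
    simp only [mem_filter, mem_insert, mem_singleton] at hA ⊢
    obtain ⟨hA | rfl | rfl, hmA⟩ := hA
    exacts [hA, absurd (mem_insert_self _ _) hmA, absurd (mem_insert_self _ _) hmA]
  · have himage : univ.image c ⊆ S := fun x hx => by
      obtain ⟨k, -, rfl⟩ := mem_image.1 hx
      exact h.mem k
    have hcard : #(S \ univ.image c) + 2 = n := by
      have := card_le_card himage
      rw [card_sdiff_of_subset himage]
      rw [card_image_of_injective _ h.injective, card_univ, Fintype.card_fin, h.card] at *
      omega
    refine mem_cliques_of_superset (C := insert m (S \ univ.image c)) ?_ (insert_nonempty _ _) ?_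
    · rw [card_insert_of_notMem fun hS => h.notMem hm (sdiff_subset hS)]
      omega
    · have hsub : ∀ k, insert m (S \ univ.image c) ⊆ insert m (S \ {c (k + 1), c (k + 2)}) :=
        fun k => insert_subset_insert _ (sdiff_subset_sdiff Subset.rfl
          (by simp [insert_subset_iff]))
      simp only [mem_insert, mem_singleton, forall_eq_or_imp, forall_eq]
      exact ⟨⟨hsub 0, h.wing_subset_Icc hm 0, h.card_wing hm 0⟩,
        ⟨hsub 1, h.wing_subset_Icc hm 1, h.card_wing hm 1⟩,
        hsub 2, h.wing_subset_Icc hm 2, h.card_wing hm 2⟩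
  · rw [filter_eq_empty_iff.2]
    · simp
    · intro A hA
      simp only [mem_insert, mem_singleton] at hA
      obtain rfl | rfl | rfl := hA <;> simp

end IsTripod

theorem thin_subset (m n : ℕ) :
    (thin m n).faces ⊆ ((cliques m n).avoid (farTriples m n)).faces := fun _ h =>
  ⟨h.1, fun τ hτ => h.2 τ hτ.1⟩

/-- An index set for the triangles that are not in `thin m n` but do not contain a member of
`farTriples m n`. -/
def triangles (m n : ℕ) : Finset (Σ _ : Finset ℕ, Finset ℕ) :=
  (powersetCard (n + 1) (Icc 1 (m - 1))).sigma fun S => powersetCard 2 (eraseTop S)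

theorem card_eraseTop (hS : #S = n + 1) : #(eraseTop S) = n := by
  rw [eraseTop, card_erase_of_mem (sup_mem (card_pos.1 (by omega))), hS, Nat.add_sub_cancel]

theorem card_triangles (m n : ℕ) :
    #(triangles m n) = (m - 1).choose (n + 1) * n.choose 2 := by
  rw [triangles, card_sigma, sum_const_nat (m := n.choose 2), card_powersetCard, Nat.card_Icc,
    Nat.add_sub_cancel]
  intro S hS
  rw [card_powersetCard, card_eraseTop (mem_powersetCard.1 hS).2]

theorem exists_isTripod {x : Σ _ : Finset ℕ, Finset ℕ} (hx : x ∈ triangles m n) :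
    ∃ c : Fin 3 → ℕ, IsTripod m n x.1 c ∧ c 0 = x.1.sup id ∧
      univ.image c = insert (x.1.sup id) x.2 := by
  obtain ⟨S, e⟩ := x
  obtain ⟨hS, he⟩ := mem_sigma.1 hx
  obtain ⟨hS, hSn⟩ := mem_powersetCard.1 hS
  obtain ⟨he, he2⟩ := mem_powersetCard.1 he
  obtain ⟨a, b, hab, rfl⟩ := card_eq_two.1 he2
  simp only [eraseTop, insert_subset_iff, singleton_subset_iff, mem_erase] at he
  obtain ⟨⟨ha, haS⟩, hb, hbS⟩ := he
  refine ⟨![S.sup id, a, b], ⟨hS, hSn, ?_, ?_⟩, rfl, ?_⟩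
  · intro i j hij
    fin_cases i <;> fin_cases j <;> simp_all [eq_comm]
  · have := sup_mem (card_pos.1 (hSn.symm ▸ Nat.succ_pos n : 0 < #S))
    intro k
    fin_cases k <;> assumption
  · ext x
    simp [Fin.exists_fin_succ, eq_comm]

theorem exists_triangle_eq (hσ : σ ∈ ((cliques m n).avoid (farTriples m n)).faces)
    (hσ' : σ ∉ (thin m n).faces) :
    ∃ x ∈ triangles m n, σ = (insert (x.1.sup id) x.2).image x.1.erase := by
  obtain ⟨hσ, hfar⟩ := hσ
  obtain ⟨-, hcard, hadj⟩ := mem_cliques.1 hσ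
  obtain ⟨τ, hτ, hτσ⟩ : ∃ τ ∈ triples m n, τ ⊆ σ := by
    by_contra! h
    exact hσ' ⟨hσ, h⟩
  have htop : eraseTop (τ.sup id) ∈ τ := by
    by_contra h
    exact hfar τ ⟨hτ, h⟩ hτσ
  have h2 : #(τ.erase (eraseTop (τ.sup id))) = 2 := by rw [card_erase_of_mem htop, hτ.1]
  obtain ⟨h3, hS, hmS⟩ := hτ
  have hsub : ∀ A ∈ σ, A ⊆ τ.sup id := fun A hA => subset_sup_of_triple hσ hτσ h3 hS hA
  have hSm := sup_subset_Icc hσ hτσ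
  set S := τ.sup id with hSdef
  obtain ⟨A, B, hAB, he⟩ := card_eq_two.1 h2
  have hA := mem_erase.1 (he ▸ mem_insert_self A {B})
  have hB : B ≠ eraseTop S ∧ B ∈ τ := mem_erase.1 (he ▸ (by simp))
  have hτeq : insert (eraseTop S) {A, B} = τ := by rw [← he, insert_erase htop]
  obtain rfl : τ = σ := by
    by_contra hne
    obtain ⟨D, hD, hDτ⟩ := exists_of_ssubset (hτσ.ssubset_of_ne hne)
    have hsup : (insert D {A, B} : Finset (Finset ℕ)).sup id = S := by
      refine eq_of_subset_of_card_le (Finset.sup_le fun C hC => hsub C ?_) ?_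
      · simp only [mem_insert, mem_singleton] at hC
        rcases hC with rfl | rfl | rfl
        exacts [hD, hτσ hA.2, hτσ hB.2]
      · by_contra! hlt
        have hA' : A ⊆ (insert D {A, B} : Finset (Finset ℕ)).sup id := subset_sup (by simp)
        have hB' : B ⊆ (insert D {A, B} : Finset (Finset ℕ)).sup id := subset_sup (by simp)
        have hcA := (hcard A (hτσ hA.2)).2
        have hcB := (hcard B (hτσ hB.2)).2
        exact hAB ((eq_of_subset_of_card_le hA' (by omega)).trans
          (eq_of_subset_of_card_le hB' (by omega)).symm)
    refine hfar (insert D {A, B}) ⟨⟨?_, by rw [hsup, hS], by rwa [hsup]⟩, ?_⟩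
      (insert_subset hD (by simp [insert_subset_iff, hτσ hA.2, hτσ hB.2]))
    · rw [card_insert_of_notMem, card_pair hAB]
      rw [← he]
      exact fun h => hDτ (mem_erase.1 h).2
    · rw [hsup]
      simp only [mem_insert, mem_singleton, not_or]
      exact ⟨fun h => hDτ (h ▸ htop), hA.1.symm, hB.1.symm⟩
  have herase : ∀ C ∈ τ, C ≠ eraseTop S → ∃ x ∈ eraseTop S, S.erase x = C := fun C hC hne => by
    obtain ⟨x, hx, hxC⟩ := exists_eq_insert_iff.2
      ⟨hsub C hC, show #C + 1 = #S by rw [(hcard C hC).2, hS]⟩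
    have hxS : S.erase x = C := by rw [← hxC, erase_insert hx]
    exact ⟨x, mem_erase.2 ⟨fun h => hne (by rw [← hxS, h, eraseTop]),
      hxC ▸ mem_insert_self x C⟩, hxS⟩
  obtain ⟨a, ha, rfl⟩ := herase A hA.2 hA.1
  obtain ⟨b, hb, rfl⟩ := herase B hB.2 hB.1
  refine ⟨⟨S, {a, b}⟩, mem_sigma.2 ⟨mem_powersetCard.2 ⟨fun x hx => ?_, hS⟩,
    mem_powersetCard.2 ⟨by simp [insert_subset_iff, ha, hb], card_pair fun h => hAB (h ▸ rfl)⟩⟩, ?_⟩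
  · have := mem_Icc.1 (hSm hx)
    have : x ≠ m := fun h => hmS (h ▸ hx)
    exact mem_Icc.2 (by omega)
  · simp only [image_insert, image_singleton]
    exact hτeq.symm

end Johnson

namespace Johnson

open AbsSC

variable {m n : ℕ} {B : Finset ℕ} {σ : Finset (Finset ℕ)}

/-- Up to homotopy, attaching all triangles to `thin m n` adds a wedge of spheres at any point
of a vertex. -/
theorem nonempty_homotopyEquiv_wedge (hm : 1 ≤ m) (x : (thin m n).space)
    (hB : {B} ∈ (thin m n).faces) (hx : ∀ A, x.wt A ≠ 0 → A = B) :
    Nonempty (ContinuousMap.HomotopyEquiv ((cliques m n).avoid (farTriples m n)).space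
      (Wedge2 (WedgeSph 2 ((m - 1).choose (n + 1) * n.choose 2)) (thin m n).space
        (wedgeSphPt 2 ((m - 1).choose (n + 1) * n.choose 2)) x)) := by
  let e := (triangles m n).equivFinOfCardEq (card_triangles m n)
  choose c htri htop himage using fun i => exists_isTripod (e.symm i).2
  have himage' : ∀ i, (univ.image fun k => (e.symm i).1.1.erase (c i k)) =
      (insert ((e.symm i).1.1.sup id) (e.symm i).1.2).image (e.symm i).1.1.erase := fun i => by
    rw [← himage i, image_image]
    rfl
  have hsub : ∀ i i', (univ.image fun k => (e.symm i).1.1.erase (c i k)) =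
      (univ.image fun k => (e.symm i').1.1.erase (c i' k)) → univ.image (c i) ⊆ univ.image (c i') :=
    fun i i' h x hx => by
      have hS : (e.symm i).1.1 = (e.symm i').1.1 := by
        rw [← (htri i).sup_image, h, (htri i').sup_image]
      obtain ⟨k, -, rfl⟩ := mem_image.1 hx
      obtain ⟨k', -, hk'⟩ := mem_image.1 (h ▸ mem_image_of_mem _ (mem_univ k))
      have : c i' k' = c i k := erase_injOn (e.symm i').1.1 ((htri i').mem k')
        (hS ▸ (htri i).mem k) (hk'.trans (by rw [hS]))
      exact this ▸ mem_image_of_mem _ (mem_univ k')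
  have hp : ∀ i k, {(e.symm i).1.1.erase (c i (k + 1)), (e.symm i).1.1.erase (c i (k + 2))} ∈
      (thin m n).faces := fun i k => (htri i).pair_mem_thin _ _
  refine (isMappingCone_attach (finite_thin m n) (thin_subset m n)
    (fun i k => (e.symm i).1.1.erase (c i k)) (fun i => (htri i).erase_injective) hp
    (fun i => (htri i).mem_avoid_farTriples (htop i))
    (fun i h => h.2 _ ((htri i).image_mem_triples hm) Subset.rfl) (fun i i' h => ?_)
    (fun s hs => or_iff_not_imp_left.2 fun hs' => ?_)).nonempty_homotopyEquiv
    (isMappingCone_wedge _ x) (homotopic_const_of_discrete _ x fun i => ?_)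
  · have hS : (e.symm i).1.1 = (e.symm i').1.1 := by
      rw [← (htri i).sup_image, h, (htri i').sup_image]
    have he : ∀ j, (e.symm j).1.2 = (univ.image (c j)).erase ((e.symm j).1.1.sup id) := fun j => by
      rw [himage, erase_insert]
      exact fun h => notMem_erase _ _
        ((mem_powersetCard.1 (mem_sigma.1 (e.symm j).2).2).1 h)
    have he' : (e.symm i).1.2 = (e.symm i').1.2 := by
      rw [he i, he i', hS, subset_antisymm (hsub i i' h) (hsub i' i h.symm)]
    exact e.symm.injective (Subtype.ext (Sigma.ext hS (heq_of_eq he')))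
  · obtain ⟨x, hx, rfl⟩ := exists_triangle_eq hs hs'
    refine ⟨e ⟨x, hx⟩, ?_⟩
    rw [himage', e.symm_apply_apply]
  · exact ((htri i).boundaryMap_homotopic hm (hp i) hB).trans (vertex_homotopic_const _ hB hx)

/-- The cliques all of whose vertices contain `m`. -/
abbrev starCliques (m n : ℕ) : AbsSC (Finset ℕ) :=
  ((thin m n).avoid (pairs m)).avoid (singles m)

theorem mem_starCliques : σ ∈ (starCliques m n).faces ↔
    σ ∈ (cliques m n).faces ∧ ∀ A ∈ σ, m ∈ A := by
  refine ⟨fun h => ⟨h.1.1.1, fun A hA => ?_⟩, fun h => ⟨⟨mem_thin h.1 ?_, fun τ hτ hsub => ?_⟩, ?_⟩⟩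
  · by_contra hm
    exact h.2 {A} ⟨A, hm, rfl⟩ (singleton_subset_iff.2 hA)
  · rw [filter_eq_empty_iff.2 fun A hA => not_not.2 (h.2 A hA)]
    simp
  · obtain ⟨A, hA⟩ : τ.Nonempty := card_pos.1 (by rw [hτ.1]; norm_num)
    exact hτ.2 A hA (h.2 A (hsub hA))
  · rintro _ ⟨A, hm, rfl⟩ hsub
    exact hm (h.2 A (singleton_subset_iff.1 hsub))

theorem image_insert_mem_starCliques (hm : 1 ≤ m) (hn : 1 ≤ n)
    (hσ : σ ∈ (cliques (m - 1) (n - 1)).faces) : σ.image (insert m) ∈ (starCliques m n).faces := by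
  obtain ⟨hne, hcard, hadj⟩ := mem_cliques.1 hσ
  have hnot : ∀ A ∈ σ, m ∉ A := fun A hA h => by
    have := mem_Icc.1 ((hcard A hA).1 h)
    omega
  refine mem_starCliques.2 ⟨mem_cliques.2 ⟨hne.image _, ?_, ?_⟩, ?_⟩
  · refine forall_mem_image.2 fun A hA => ⟨insert_subset (mem_Icc.2 ⟨hm, le_rfl⟩)
      ((hcard A hA).1.trans (Icc_subset_Icc_right (Nat.sub_le m 1))), ?_⟩
    rw [card_insert_of_notMem (hnot A hA), (hcard A hA).2]
    omega
  · refine forall_mem_image.2 fun A hA => forall_mem_image.2 fun B hB => ?_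
    have := hadj A hA B hB
    rw [← insert_inter_distrib, card_insert_of_notMem fun h => hnot A hA (mem_inter.1 h).1]
    omega
  · exact forall_mem_image.2 fun A _ => mem_insert_self m A

theorem image_erase_mem_cliques (hσ : σ ∈ (starCliques m n).faces) :
    σ.image (fun A => A.erase m) ∈ (cliques (m - 1) (n - 1)).faces := by
  obtain ⟨hσ, hmem⟩ := mem_starCliques.1 hσ
  obtain ⟨hne, hcard, hadj⟩ := mem_cliques.1 hσ
  refine mem_cliques.2 ⟨hne.image _, ?_, ?_⟩
  · refine forall_mem_image.2 fun A hA => ⟨fun x hx => ?_, ?_⟩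
    · have := (mem_erase.1 hx).1
      have := mem_Icc.1 ((hcard A hA).1 (mem_erase.1 hx).2)
      exact mem_Icc.2 (by omega)
    · rw [card_erase_of_mem (hmem A hA), (hcard A hA).2]
  · refine forall_mem_image.2 fun A hA => forall_mem_image.2 fun B hB => ?_
    have := hadj A hA B hB
    rw [erase_inter, inter_erase, erase_idem, card_erase_of_mem (mem_inter.2 ⟨hmem A hA, hmem B hB⟩)]
    omega

theorem erase_insert_of_mem_cliques (hm : 1 ≤ m) :
    ∀ s ∈ (cliques (m - 1) (n - 1)).faces, ∀ A ∈ s, (insert m A).erase m = A :=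
  fun s hs A hA => erase_insert fun h => by
    have := mem_Icc.1 (((mem_cliques.1 hs).2.1 A hA).1 h)
    omega

theorem insert_erase_of_mem_starCliques :
    ∀ s ∈ (starCliques m n).faces, ∀ A ∈ s, insert m (A.erase m) = A :=
  fun _ hs A hA => insert_erase ((mem_starCliques.1 hs).2 A hA)

end Johnson

/-- For `1 < n < m - 1`,
`VR(F_n^m, 2) ≃ (∨_{C(m-1, n+1)·C(n,2)} S²) ∨ VR(F_{n-1}^{m-1}, 2)`. -/
theorem stmt8 (m n : ℕ) (h1 : 1 < n) (h2 : n + 1 < m) :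
    ∃ y : (VRc (Fnm (m - 1) (n - 1)) 2).space,
      Nonempty (ContinuousMap.HomotopyEquiv ((VRc (Fnm m n) 2).space)
        (Wedge2 (WedgeSph 2 ((m - 1).choose (n + 1) * n.choose 2))
          ((VRc (Fnm (m - 1) (n - 1)) 2).space)
          (wedgeSphPt 2 ((m - 1).choose (n + 1) * n.choose 2)) y)) := by
  have hm : 1 ≤ m := by omega
  have hn : 1 ≤ n := h1.le
  have hA : {Icc 1 (n - 1)} ∈ (Johnson.cliques (m - 1) (n - 1)).faces :=
    Johnson.mem_cliques.2 ⟨singleton_nonempty _,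
      by simpa using Icc_subset_Icc_right (a := 1) (show n - 1 ≤ m - 1 by omega), by simp; omega⟩
  let x := AbsSC.space.vertex _ hA
  have hstar : {insert m (Icc 1 (n - 1))} ∈ (Johnson.starCliques m n).faces := by
    simpa using Johnson.image_insert_mem_starCliques hm hn hA
  let T := AbsSC.transport (insert m) (fun A => A.erase m)
    (fun s => Johnson.image_insert_mem_starCliques (n := n) hm hn)
    (Johnson.erase_insert_of_mem_cliques (n := n) hm)
  have hT : IsStrongDeformationRetract T := AbsSC.isStrongDeformationRetract_transport
    (fun s => Johnson.image_erase_mem_cliques) Johnson.insert_erase_of_mem_starCliques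
  obtain ⟨r, hr, H, -⟩ := Johnson.isStrongDeformationRetract_avoid_farTriples m n
  let E : ContinuousMap.HomotopyEquiv _ _ :=
    ⟨r, AbsSC.incl (AbsSC.avoid_subset _ _), ⟨H.symm⟩, hr ▸ .refl _⟩
  obtain ⟨E₁⟩ := Johnson.nonempty_homotopyEquiv_wedge hm
    (AbsSC.incl (AbsSC.avoid_subset _ _) (AbsSC.incl (AbsSC.avoid_subset _ _) (T x)))
    hstar.1.1 fun A hA => by
      change (if insert m (A.erase m) = A then x.wt (A.erase m) else 0) ≠ 0 at hA
      rw [ite_ne_right_iff] at hA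
      rw [← hA.1, AbsSC.space.eq_of_wt_vertex_ne_zero hA.2]
  obtain ⟨E₂⟩ := IsMappingCone.nonempty_homotopyEquiv_of_retract
    (Johnson.isStrongDeformationRetract_avoid_pairs hm n)
    (isMappingCone_wedge ((m - 1).choose (n + 1) * n.choose 2) _) (isMappingCone_wedge _ _)
  obtain ⟨E₃⟩ := IsMappingCone.nonempty_homotopyEquiv_of_retract
    (Johnson.isStrongDeformationRetract_avoid_singles hm hn)
    (isMappingCone_wedge ((m - 1).choose (n + 1) * n.choose 2) _) (isMappingCone_wedge _ _)
  obtain ⟨E₄⟩ := IsMappingCone.nonempty_homotopyEquiv_of_retract hT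
    (isMappingCone_wedge ((m - 1).choose (n + 1) * n.choose 2) _) (isMappingCone_wedge _ _)
  exact ⟨x, ⟨(((E.trans E₁).trans E₂).trans E₃).trans E₄⟩⟩
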